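/- arXiv:1903.00236 — 2 statements merged into one kernel-verified Lean document; each statement's English description precedes it below -/
import Mathlib

section
/- Assume: (1) ζ is locally Lipschitz continuous, θ(x,t) is continuous, differentiable in x, with ∇_x θ continuous; (2) the multifunction F(x,t) is continuous with nonempty compact convex values, its support function s(F(x,t),ψ) is differentiable in x, and (x,t,ψ) ↦ ∇_x s(F(x,t),ψ) is continuous; (3) there exists a globally optimal solution of the differential-inclusion problem; (4) there exist λ₀ > 0, δ > 0 and c > I* such that S_{λ₀}(c) ∩ Ω_δ is bounded in W^{1,p}_d(0,T) and Φ_{λ₀} is bounded below on A. Then there exists λ* ≥ 0 such that for any λ ≥ λ* the penalty function Φ_λ is completely exact on S_λ(c). -/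
open MeasureTheory Set Filter Topology
open scoped ENNReal NNReal

noncomputable section

/-- `ℝ^n` as a Euclidean space. -/
abbrev Vec (n : ℕ) := EuclideanSpace ℝ (Fin n)

/-- Lebesgue measure restricted to the interval `(0, T]`. -/
noncomputable def muT (T : ℝ) : Measure ℝ := volume.restrict (Set.Ioc 0 T)

/-- Membership in `W^{1,p}_d(0,T)`: `x` is absolutely continuous on `[0,T]` with derivative
`x' ∈ L^p(0,T)`. -/
def InW {d : ℕ} (T p : ℝ) (x x' : ℝ → Vec d) : Prop :=
  IntervalIntegrable x' volume 0 T ∧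
  (∀ t ∈ Set.Icc 0 T, x t = x 0 + ∫ s in (0:ℝ)..t, x' s) ∧
  MemLp x' (ENNReal.ofReal p) (muT T)

/-- The support function `s(Y, ψ) = sup_{y ∈ Y} ⟨y, ψ⟩` of the value `Y = F(x,t)`. -/
noncomputable def suppF {d : ℕ} (F : Vec d → ℝ → Set (Vec d)) (x : Vec d) (t : ℝ)
    (ψ : Vec d) : ℝ :=
  sSup ((fun y => (inner ℝ y ψ : ℝ)) '' F x t)

/-- The function `h(x,z,t) = max_{ψ ∈ S} max{0, ⟨z,ψ⟩ − s(F(x,t),ψ)}` (which equals the distance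
from `z` to `F(x,t)`). -/
noncomputable def hfun {d : ℕ} (F : Vec d → ℝ → Set (Vec d)) (x z : Vec d) (t : ℝ) : ℝ :=
  sSup ((fun ψ => max 0 ((inner ℝ z ψ : ℝ) - suppF F x t ψ)) ''
    Metric.sphere (0 : Vec d) 1)

/-- The penalty term `φ(x) = ‖h(x(·), ẋ(·), ·)‖_p` (with values in `[0,+∞]`). -/
noncomputable def phiDI {d : ℕ} (T p : ℝ) (F : Vec d → ℝ → Set (Vec d))
    (x x' : ℝ → Vec d) : ℝ≥0∞ :=
  eLpNorm (fun t => hfun F (x t) (x' t) t) (ENNReal.ofReal p) (muT T)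

/-- Points of `W^{1,p}_d(0,T)`, represented as pairs `(x, ẋ)`. -/
abbrev TrajDI (d : ℕ) := (ℝ → Vec d) × (ℝ → Vec d)

/-- The set `A = {x ∈ W^{1,p}_d(0,T) : x(0) = x₀}`. -/
def AsetDI {d : ℕ} (T p : ℝ) (x₀ : Vec d) : Set (TrajDI d) :=
  {z | InW T p z.1 z.2 ∧ z.1 0 = x₀}

/-- The feasible set `Ω = {x ∈ A : ẋ(t) ∈ F(x(t),t) a.e.}`. -/
def OsetDI {d : ℕ} (T p : ℝ) (x₀ : Vec d) (F : Vec d → ℝ → Set (Vec d)) :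
    Set (TrajDI d) :=
  {z ∈ AsetDI T p x₀ | ∀ᵐ t ∂(muT T), z.2 t ∈ F (z.1 t) t}

/-- The objective functional `I(x) = ∫₀^T θ(x(t),t) dt + ζ(x(T))`. -/
noncomputable def IvalDI {d : ℕ} (T : ℝ) (θ : Vec d → ℝ → ℝ) (ζ : Vec d → ℝ)
    (z : TrajDI d) : ℝ :=
  (∫ t in Set.Ioc (0:ℝ) T, θ (z.1 t) t) + ζ (z.1 T)

/-- The penalty function `Φ_λ(x) = I(x) + λ φ(x)`. -/
noncomputable def PhiDI {d : ℕ} (T p : ℝ) (θ : Vec d → ℝ → ℝ) (ζ : Vec d → ℝ)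
    (F : Vec d → ℝ → Set (Vec d)) (lam : ℝ) (z : TrajDI d) : EReal :=
  ((IvalDI T θ ζ z : ℝ) : EReal) + (lam : EReal) * ((phiDI T p F z.1 z.2 : ℝ≥0∞) : EReal)

/-- The distance in `W^{1,p}_d(0,T)`. -/
noncomputable def distDI {d : ℕ} (T p : ℝ) (z w : TrajDI d) : ℝ :=
  (eLpNorm (fun t => z.1 t - w.1 t) (ENNReal.ofReal p) (muT T)).toReal +
    (eLpNorm (fun t => z.2 t - w.2 t) (ENNReal.ofReal p) (muT T)).toReal

/-- The norm in `W^{1,p}_d(0,T)`. -/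
noncomputable def normDI {d : ℕ} (T p : ℝ) (z : TrajDI d) : ℝ :=
  (eLpNorm z.1 (ENNReal.ofReal p) (muT T)).toReal +
    (eLpNorm z.2 (ENNReal.ofReal p) (muT T)).toReal

/-- The rate of steepest descent of `g` w.r.t. `K` at `z`, for a distance function `dd`. -/
noncomputable def rateDescentWith {Z : Type*} (dd : Z → Z → ℝ) (g : Z → EReal) (K : Set Z)
    (z : Z) : EReal :=
  Filter.liminf (fun w => (g w - g z) * (((dd w z)⁻¹ : ℝ) : EReal))
    (⨅ (ε : ℝ) (_ : 0 < ε), Filter.principal {w | w ∈ K ∧ 0 < dd w z ∧ dd w z < ε})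

theorem rateDescentWith_nonneg_iff {Z : Type*} {dd : Z → Z → ℝ} {g : Z → EReal} {G : Z → ℝ}
    {K : Set Z} {z : Z} (hK : ∀ w ∈ K, g w = (G w : EReal)) (hz : g z = (G z : EReal)) :
    (0 : EReal) ≤ rateDescentWith dd g K z ↔
      ∀ η > 0, ∃ ε > 0, ∀ w ∈ K, 0 < dd w z → dd w z < ε → -η * dd w z ≤ G w - G z := by
  have hbasis : (⨅ (ε : ℝ) (_ : 0 < ε),
      Filter.principal {w | w ∈ K ∧ 0 < dd w z ∧ dd w z < ε}).HasBasis (fun ε : ℝ => 0 < ε)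
      (fun ε => {w | w ∈ K ∧ 0 < dd w z ∧ dd w z < ε}) := by
    refine Filter.hasBasis_biInf_principal' (fun i hi j hj => ?_) ⟨1, one_pos⟩
    exact ⟨min i j, lt_min hi hj, fun w hw => ⟨hw.1, hw.2.1, hw.2.2.trans_le (min_le_left _ _)⟩,
      fun w hw => ⟨hw.1, hw.2.1, hw.2.2.trans_le (min_le_right _ _)⟩⟩
  have hq : ∀ w ∈ K, (g w - g z) * (((dd w z)⁻¹ : ℝ) : EReal)
      = (((G w - G z) / dd w z : ℝ) : EReal) := by
    intro w hw
    rw [hK w hw, hz, div_eq_mul_inv, EReal.coe_mul, EReal.coe_sub]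
  unfold rateDescentWith
  rw [Filter.le_liminf_iff]
  constructor
  · intro h η hη
    obtain ⟨ε, hε, hsub⟩ := hbasis.eventually_iff.1
      (h ((-η : ℝ) : EReal) (by exact_mod_cast neg_lt_zero.2 hη))
    refine ⟨ε, hε, fun w hw h0 hlt => ?_⟩
    have := hsub (show w ∈ {w | w ∈ K ∧ 0 < dd w z ∧ dd w z < ε} from ⟨hw, h0, hlt⟩)
    rw [hq w hw, EReal.coe_lt_coe_iff, lt_div_iff₀ h0] at this
    exact this.le
  · intro h y hy
    obtain ⟨r, hyr, hr⟩ := EReal.lt_iff_exists_real_btwn.1 hy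
    have hr' : r < 0 := by exact_mod_cast hr
    obtain ⟨ε, hε, hsub⟩ := h (-r) (neg_pos.2 hr')
    refine hbasis.eventually_iff.2 ⟨ε, hε, fun w hw => ?_⟩
    refine hyr.trans_le ?_
    rw [hq w hw.1, EReal.coe_le_coe_iff, le_div_iff₀ hw.2.1]
    simpa using hsub w hw.1 hw.2.1 hw.2.2

/-- Complete exactness of a penalty function from a proportional-decrease property: from every
point of the sublevel set the penalty term can be reduced by any factor `1 - s` at a cost, in the
distance, of at most `K * s` times the penalty term. -/
theorem completely_exact_of_proportional_decrease {Z : Type*} {A O U : Set Z} {I φ : Z → ℝ}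
    {dd : Z → Z → ℝ} {Phi : Z → EReal} {zopt : Z} {c K L lam : ℝ}
    (hO : ∀ z, z ∈ O ↔ z ∈ A ∧ φ z = 0) (hφ : ∀ z ∈ A, 0 ≤ φ z)
    (hdd : ∀ z w, 0 ≤ dd z w)
    (htri : ∀ x ∈ A, ∀ y ∈ A, ∀ z ∈ A, dd x z ≤ dd x y + dd y z)
    (hdd0 : ∀ z ∈ A, ∀ w ∈ A, dd w z = 0 → φ w = φ z)
    (hPhi : ∀ z ∈ A, Phi z = ((I z + lam * φ z : ℝ) : EReal))
    (hzopt : zopt ∈ O) (hmin : ∀ w ∈ O, I zopt ≤ I w) (hc : I zopt < c)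
    (hK : 0 < K) (hL : 0 ≤ L) (hlam : L * K < lam)
    (hLip : ∀ z ∈ U, ∀ w ∈ U, |I w - I z| ≤ L * dd w z)
    (hU : ∀ z ∈ A, I z + lam * φ z < c → z ∈ U)
    (hdec : ∀ z ∈ A, I z + lam * φ z < c → ∀ s ∈ Icc (0 : ℝ) 1,
      ∃ w ∈ A, w ∈ U ∧ φ w ≤ (1 - s) * φ z ∧ dd w z ≤ K * s * φ z) :
    (⨅ z ∈ A, Phi z) = ((I zopt : ℝ) : EReal) ∧
    ({z ∈ A | ∀ w ∈ A, Phi z ≤ Phi w} = {z ∈ O | ∀ w ∈ O, I z ≤ I w}) ∧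
    (∀ z ∈ A, Phi z < ((c : ℝ) : EReal) →
      ((∃ ε : ℝ, 0 < ε ∧ ∀ w ∈ A, dd w z < ε → Phi z ≤ Phi w) ↔
        (z ∈ O ∧ ∃ ε : ℝ, 0 < ε ∧ ∀ w ∈ O, dd w z < ε → I z ≤ I w))) ∧
    (∀ z ∈ A, Phi z < ((c : ℝ) : EReal) →
      ((0 : EReal) ≤ rateDescentWith dd Phi A z ↔
        (z ∈ O ∧ (0 : EReal) ≤ rateDescentWith dd (fun w => ((I w : ℝ) : EReal)) O z))) := by
  have hlam0 : 0 < lam := lt_of_le_of_lt (mul_nonneg hL hK.le) hlam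
  have hOA : ∀ z ∈ O, z ∈ A := fun z hz => ((hO z).1 hz).1
  have hPhiO : ∀ z ∈ O, Phi z = ((I z : ℝ) : EReal) := by
    intro z hz
    rw [hPhi z (hOA z hz), ((hO z).1 hz).2, mul_zero, add_zero]
  have hlt : ∀ z ∈ A, Phi z < ((c : ℝ) : EReal) → I z + lam * φ z < c := by
    intro z hz h
    rw [hPhi z hz] at h
    exact_mod_cast h
  -- descent along the decreasing family
  have hdescent : ∀ z ∈ A, I z + lam * φ z < c → ∀ s ∈ Icc (0 : ℝ) 1,
      ∃ w ∈ A, w ∈ U ∧ φ w ≤ (1 - s) * φ z ∧ dd w z ≤ K * s * φ z ∧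
        I w + lam * φ w ≤ I z + lam * φ z - (lam - L * K) * (s * φ z) := by
    intro z hz h s hs
    obtain ⟨w, hwA, hwU, h1, h2⟩ := hdec z hz h s hs
    refine ⟨w, hwA, hwU, h1, h2, ?_⟩
    have h3 := (abs_le.1 (hLip z (hU z hz h) w hwU)).2
    have h4 := mul_le_mul_of_nonneg_left h2 hL
    have h5 := mul_le_mul_of_nonneg_left h1 hlam0.le
    linarith
  have hfeas : ∀ z ∈ A, I z + lam * φ z < c →
      ∃ y ∈ O, y ∈ U ∧ dd y z ≤ K * φ z ∧ I y + (lam - L * K) * φ z ≤ I z + lam * φ z := by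
    intro z hz h
    obtain ⟨w, hwA, hwU, h1, h2, h3⟩ := hdescent z hz h 1 ⟨zero_le_one, le_rfl⟩
    have hw0 : φ w = 0 := le_antisymm (by linarith) (hφ w hwA)
    refine ⟨w, (hO w).2 ⟨hwA, hw0⟩, hwU, by linarith, ?_⟩
    rw [hw0] at h3
    linarith
  have hlower : ∀ z ∈ A, I zopt ≤ I z + lam * φ z ∧
      (φ z ≠ 0 → I zopt < I z + lam * φ z) := by
    intro z hz
    by_cases h : I z + lam * φ z < c
    · obtain ⟨y, hy, -, -, h3⟩ := hfeas z hz h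
      have h4 := hmin y hy
      have h5 := mul_nonneg (sub_pos.2 hlam).le (hφ z hz)
      refine ⟨by linarith, fun hne => ?_⟩
      have := mul_pos (sub_pos.2 hlam) (lt_of_le_of_ne (hφ z hz) (Ne.symm hne))
      linarith
    · exact ⟨by linarith, fun _ => by linarith⟩
  -- comparison of a nearby point having a smaller value with a nearby feasible point
  have hnear : ∀ z ∈ O, I z < c → ∀ w ∈ A, I w + lam * φ w < I z →
      ∃ y ∈ O, y ∈ U ∧ dd y z ≤ 2 * dd w z ∧ I y ≤ I w + lam * φ w := by
    intro z hz hzc w hw hwz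
    have hz0 : φ z = 0 := ((hO z).1 hz).2
    have hzU : z ∈ U := hU z (hOA z hz) (by rw [hz0]; linarith)
    have hwc : I w + lam * φ w < c := hwz.trans hzc
    obtain ⟨y, hy, hyU, h2, h3⟩ := hfeas w hw hwc
    have h4 := (abs_le.1 (hLip z hzU w (hU w hw hwc))).1
    have h5 : lam * φ w ≤ L * dd w z := by linarith
    have h6 : K * φ w ≤ dd w z := by
      have h7 : L * K * dd w z ≤ lam * dd w z := mul_le_mul_of_nonneg_right hlam.le (hdd _ _)
      have h8 : K * (lam * φ w) ≤ K * (L * dd w z) := mul_le_mul_of_nonneg_left h5 hK.le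
      refine le_of_mul_le_mul_left ?_ hlam0
      nlinarith
    refine ⟨y, hy, hyU, ?_, ?_⟩
    · have := htri y (hOA y hy) w hw z (hOA z hz)
      linarith
    · have := mul_nonneg (sub_pos.2 hlam).le (hφ w hw)
      linarith
  refine ⟨le_antisymm ?_ ?_, ?_, ?_, ?_⟩
  · exact (iInf₂_le zopt (hOA _ hzopt)).trans (hPhiO _ hzopt).le
  · refine le_iInf₂ fun z hz => ?_
    rw [hPhi z hz]
    exact_mod_cast (hlower z hz).1
  · ext z
    constructor
    · rintro ⟨hz, h⟩
      have h1 := h zopt (hOA _ hzopt)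
      rw [hPhi z hz, hPhiO _ hzopt, EReal.coe_le_coe_iff] at h1
      have h0 : φ z = 0 := by
        by_contra hne
        exact absurd ((hlower z hz).2 hne) (not_lt.2 h1)
      rw [h0] at h1
      refine ⟨(hO z).2 ⟨hz, h0⟩, fun w hw => ?_⟩
      have := hmin w hw
      linarith
    · rintro ⟨hz, h⟩
      refine ⟨hOA z hz, fun w hw => ?_⟩
      rw [hPhiO z hz, hPhi w hw, EReal.coe_le_coe_iff]
      exact (h zopt hzopt).trans (hlower w hw).1
  · intro z hz hzc
    have hzc' := hlt z hz hzc
    constructor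
    · rintro ⟨ε, hε, h⟩
      have h0 : φ z = 0 := by
        by_contra hne
        have hpos : 0 < φ z := lt_of_le_of_ne (hφ z hz) (Ne.symm hne)
        have hden : 0 < K * φ z := mul_pos hK hpos
        set s := min 1 (ε / (2 * (K * φ z))) with hs
        have hs0 : 0 < s := lt_min one_pos (by positivity)
        obtain ⟨w, hwA, -, -, h2, h3⟩ := hdescent z hz hzc' s ⟨hs0.le, min_le_left _ _⟩
        have h4 : s * (2 * (K * φ z)) ≤ ε :=
          (le_div_iff₀ (by positivity)).1 (min_le_right _ _)
        have h5 := h w hwA (by nlinarith)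
        rw [hPhi z hz, hPhi w hwA, EReal.coe_le_coe_iff] at h5
        have := mul_pos (sub_pos.2 hlam) (mul_pos hs0 hpos)
        linarith
      have hzO := (hO z).2 ⟨hz, h0⟩
      refine ⟨hzO, ε, hε, fun w hw hd => ?_⟩
      have := h w (hOA w hw) hd
      rwa [hPhiO z hzO, hPhiO w hw, EReal.coe_le_coe_iff] at this
    · rintro ⟨hzO, ε, hε, h⟩
      refine ⟨ε / 2, by positivity, fun w hw hd => ?_⟩
      rw [hPhiO z hzO, hPhi w hw, EReal.coe_le_coe_iff]
      by_contra! hcon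
      rw [((hO z).1 hzO).2] at hzc'
      obtain ⟨y, hy, -, h1, h2⟩ := hnear z hzO (by linarith) w hw hcon
      have := h y hy (by linarith)
      linarith
  · intro z hz hzc
    have hzc' := hlt z hz hzc
    rw [rateDescentWith_nonneg_iff hPhi (hPhi z hz),
      rateDescentWith_nonneg_iff (G := I) (fun _ _ => rfl) rfl]
    constructor
    · intro h
      have h0 : φ z = 0 := by
        by_contra hne
        have hpos : 0 < φ z := lt_of_le_of_ne (hφ z hz) (Ne.symm hne)
        have hden : 0 < K * φ z := mul_pos hK hpos
        obtain ⟨ε, hε, h⟩ := h ((lam - L * K) / (2 * K)) (div_pos (sub_pos.2 hlam) (by positivity))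
        set s := min 1 (ε / (2 * (K * φ z))) with hs
        have hs0 : 0 < s := lt_min one_pos (by positivity)
        obtain ⟨w, hwA, -, h1, h2, h3⟩ := hdescent z hz hzc' s ⟨hs0.le, min_le_left _ _⟩
        have h4 : s * (2 * (K * φ z)) ≤ ε :=
          (le_div_iff₀ (by positivity)).1 (min_le_right _ _)
        have hsp : 0 < s * φ z := mul_pos hs0 hpos
        have hdpos : 0 < dd w z := by
          refine lt_of_le_of_ne (hdd _ _) fun hd => ?_
          have := hdd0 z hz w hwA hd.symm
          nlinarith
        have h5 := h w hwA hdpos (by nlinarith)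
        have h6 := mul_pos (sub_pos.2 hlam) hsp
        have h7 : (lam - L * K) / (2 * K) * dd w z ≤ (lam - L * K) / (2 * K) * (K * s * φ z) :=
          mul_le_mul_of_nonneg_left h2 (div_pos (sub_pos.2 hlam) (by positivity)).le
        have h8 : (lam - L * K) / (2 * K) * (K * s * φ z) = (lam - L * K) * (s * φ z) / 2 := by
          field_simp
        linarith
      have hzO := (hO z).2 ⟨hz, h0⟩
      refine ⟨hzO, fun η hη => ?_⟩
      obtain ⟨ε, hε, h⟩ := h η hη
      refine ⟨ε, hε, fun w hw hd hd' => ?_⟩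
      have := h w (hOA w hw) hd hd'
      rwa [h0, ((hO w).1 hw).2, mul_zero, add_zero, add_zero] at this
    · rintro ⟨hzO, h⟩ η hη
      have h0 : φ z = 0 := ((hO z).1 hzO).2
      rw [h0] at hzc' ⊢
      obtain ⟨ε, hε, h⟩ := h (η / 2) (by positivity)
      refine ⟨ε / 2, by positivity, fun w hw hd hd' => ?_⟩
      by_contra! hcon
      have hηd : 0 < η * dd w z := mul_pos hη hd
      obtain ⟨y, hy, hyU, h1, h2⟩ := hnear z hzO (by linarith) w hw (by linarith)
      have hyz : -(η / 2) * dd y z ≤ I y - I z := by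
        rcases (hdd y z).eq_or_lt with h4 | h4
        · have := hLip z (hU z hz (by rw [h0]; linarith)) y hyU
          rw [← h4, mul_zero] at this
          rw [← h4, mul_zero]
          exact (abs_nonpos_iff.1 this).ge
        · exact h y hy h4 (by linarith)
      nlinarith

section Projection

variable {E : Type*} [NormedAddCommGroup E] [InnerProductSpace ℝ E]

/-- `p` is the metric projection of `z` onto the convex set `K`, in variational form. -/
def IsProjOn (K : Set E) (z p : E) : Prop :=
  p ∈ K ∧ ∀ q ∈ K, inner ℝ (z - p) (q - p) ≤ (0 : ℝ)

theorem exists_isProjOn {K : Set E} (hne : K.Nonempty) (hcomp : IsCompact K)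
    (hconv : Convex ℝ K) (z : E) : ∃ p, IsProjOn K z p := by
  obtain ⟨p, hp, h⟩ := exists_norm_eq_iInf_of_complete_convex hne hcomp.isComplete hconv z
  exact ⟨p, hp, (norm_eq_iInf_iff_real_inner_le_zero hconv hp).1 h⟩

theorem IsProjOn.norm_sub_le {K : Set E} {z p q : E} (h : IsProjOn K z p) (hq : q ∈ K) :
    ‖z - p‖ ≤ ‖z - q‖ := by
  have h1 := h.2 q hq
  have h2 : inner ℝ (z - p) (z - q) = ‖z - p‖ ^ 2 - (inner ℝ (z - p) (q - p) : ℝ) := by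
    rw [← real_inner_self_eq_norm_sq, ← inner_sub_right]
    congr 1
    abel
  have h3 := real_inner_le_norm (z - p) (z - q)
  by_contra! hcon
  have h4 : 0 < ‖z - p‖ := lt_of_le_of_lt (norm_nonneg _) hcon
  nlinarith

/-- Stability of metric projections: perturbing the point by `a` and the set by `e`. -/
theorem IsProjOn.norm_sub_sq_le {K K' : Set E} {z z' p p' q q' : E} {e : ℝ}
    (h : IsProjOn K z p) (h' : IsProjOn K' z' p') (hq : q ∈ K') (hq' : q' ∈ K)
    (hqp : ‖q - p‖ ≤ e) (hqp' : ‖q' - p'‖ ≤ e) :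
    ‖p' - p‖ ^ 2 ≤ ‖z' - z‖ * ‖p' - p‖ + e * (2 * ‖z - p‖ + ‖z' - z‖ + e) := by
  have h1 := h.2 q' hq'
  have h2 := h'.2 q hq
  have h3 : ‖z' - p'‖ ≤ ‖z' - z‖ + ‖z - p‖ + e := by
    refine (h'.norm_sub_le hq).trans ?_
    calc ‖z' - q‖ = ‖(z' - z) + (z - p) - (q - p)‖ := by congr 1; abel
      _ ≤ ‖(z' - z) + (z - p)‖ + ‖q - p‖ := _root_.norm_sub_le _ _
      _ ≤ ‖z' - z‖ + ‖z - p‖ + e := add_le_add (norm_add_le _ _) hqp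
  have h4 : ‖p' - p‖ ^ 2 = (inner ℝ (z' - z) (p' - p) : ℝ) + inner ℝ (z - p) (q' - p)
      - inner ℝ (z - p) (q' - p') + inner ℝ (z' - p') (q - p') - inner ℝ (z' - p') (q - p) := by
    rw [← real_inner_self_eq_norm_sq]
    simp only [inner_sub_left, inner_sub_right]
    simp only [real_inner_comm]
    ring
  have h5 := real_inner_le_norm (z' - z) (p' - p)
  have h6 := neg_le_of_abs_le (abs_real_inner_le_norm (z - p) (q' - p'))
  have h7 := neg_le_of_abs_le (abs_real_inner_le_norm (z' - p') (q - p))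
  have he : 0 ≤ e := (norm_nonneg _).trans hqp
  have h8 : ‖z - p‖ * ‖q' - p'‖ ≤ ‖z - p‖ * e := mul_le_mul_of_nonneg_left hqp' (norm_nonneg _)
  have h9 : ‖z' - p'‖ * ‖q - p‖ ≤ (‖z' - z‖ + ‖z - p‖ + e) * e :=
    mul_le_mul h3 hqp (norm_nonneg _) ((norm_nonneg _).trans h3)
  nlinarith

theorem IsProjOn.norm_sub_le_norm_sub {K : Set E} {z z' p p' : E}
    (h : IsProjOn K z p) (h' : IsProjOn K z' p') : ‖p' - p‖ ≤ ‖z' - z‖ := by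
  have := h.norm_sub_sq_le (e := 0) h' h.1 h'.1 (by simp) (by simp)
  by_contra! hcon
  have : 0 < ‖p' - p‖ := lt_of_le_of_lt (norm_nonneg _) hcon
  nlinarith

/-- Joint continuity of the projection onto a continuously varying convex compact set. -/
theorem continuous_of_isProjOn {X : Type*} [TopologicalSpace X]
    {K : X → TopologicalSpace.NonemptyCompacts E} (hK : Continuous K) {P : X → E → E}
    (hP : ∀ x z, IsProjOn (K x : Set E) z (P x z)) : Continuous fun w : X × E => P w.1 w.2 := by
  rw [continuous_iff_continuousAt]
  rintro ⟨x, z⟩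
  have hfin : ∀ x y, Metric.hausdorffEDist (K x : Set E) (K y) ≠ ⊤ := fun x y =>
    Metric.hausdorffEDist_ne_top_of_nonempty_of_bounded (K x).nonempty (K y).nonempty
      (K x).isCompact.isBounded (K y).isCompact.isBounded
  have key : ∀ w : X × E, ‖P w.1 w.2 - P x z‖ ^ 2 ≤ ‖w.2 - z‖ * ‖P w.1 w.2 - P x z‖ +
      dist (K w.1) (K x) * (2 * ‖z - P x z‖ + ‖w.2 - z‖ + dist (K w.1) (K x)) := by
    rintro ⟨y, v⟩
    have hd : dist (K y) (K x) = Metric.hausdorffDist (K y : Set E) (K x) := rfl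
    obtain ⟨q, hq, hqd⟩ := (K y).isCompact.exists_infDist_eq_dist (K y).nonempty (P x z)
    obtain ⟨q', hq', hqd'⟩ := (K x).isCompact.exists_infDist_eq_dist (K x).nonempty (P y v)
    refine (hP x z).norm_sub_sq_le (hP y v) hq hq' ?_ ?_
    · rw [← dist_eq_norm, dist_comm, ← hqd, hd, Metric.hausdorffDist_comm]
      exact Metric.infDist_le_hausdorffDist_of_mem (hP x z).1 (hfin _ _)
    · rw [← dist_eq_norm, dist_comm, ← hqd', hd]
      exact Metric.infDist_le_hausdorffDist_of_mem (hP y v).1 (hfin _ _)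
  have key2 : ∀ w : X × E, ‖P w.1 w.2 - P x z‖ ≤ ‖w.2 - z‖ +
      √(dist (K w.1) (K x) * (2 * ‖z - P x z‖ + ‖w.2 - z‖ + dist (K w.1) (K x))) := by
    intro w
    have hb : 0 ≤ dist (K w.1) (K x) * (2 * ‖z - P x z‖ + ‖w.2 - z‖ + dist (K w.1) (K x)) := by
      positivity
    have h1 := key w
    have h2 := Real.sq_sqrt hb
    have h3 := Real.sqrt_nonneg
      (dist (K w.1) (K x) * (2 * ‖z - P x z‖ + ‖w.2 - z‖ + dist (K w.1) (K x)))
    have h4 := norm_nonneg (w.2 - z)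
    by_contra! hcon
    nlinarith
  rw [ContinuousAt, tendsto_iff_norm_sub_tendsto_zero]
  refine squeeze_zero (fun _ => norm_nonneg _) key2 ?_
  have hcont : Continuous fun w : X × E => ‖w.2 - z‖ +
      √(dist (K w.1) (K x) * (2 * ‖z - P x z‖ + ‖w.2 - z‖ + dist (K w.1) (K x))) := by
    have : Continuous fun w : X × E => K w.1 := hK.comp continuous_fst
    fun_prop
  simpa using hcont.tendsto (x, z)

end Projection

theorem IsProjOn.hfun_eq {d : ℕ} {F : Vec d → ℝ → Set (Vec d)} {a z p : Vec d} {t : ℝ}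
    (hcomp : IsCompact (F a t)) (h : IsProjOn (F a t) z p) : hfun F a z t = ‖z - p‖ := by
  have hbd : ∀ ψ : Vec d, BddAbove ((fun y => (inner ℝ y ψ : ℝ)) '' F a t) := fun ψ =>
    (hcomp.image (by fun_prop)).bddAbove
  have hup : ∀ x ∈ (fun ψ => max 0 ((inner ℝ z ψ : ℝ) - suppF F a t ψ)) ''
      Metric.sphere (0 : Vec d) 1, x ≤ ‖z - p‖ := by
    rintro _ ⟨ψ, hψ, rfl⟩
    have hψ1 : ‖ψ‖ = 1 := by simpa using hψ
    refine max_le (norm_nonneg _) ?_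
    have h1 : (inner ℝ p ψ : ℝ) ≤ suppF F a t ψ := le_csSup (hbd ψ) ⟨p, h.1, rfl⟩
    have h2 := real_inner_le_norm (z - p) ψ
    rw [inner_sub_left, hψ1, mul_one] at h2
    linarith
  refine le_antisymm (Real.sSup_le hup (norm_nonneg _)) ?_
  by_cases hzp : z = p
  · rw [hzp, sub_self, norm_zero]
    refine Real.sSup_nonneg ?_
    rintro _ ⟨ψ, -, rfl⟩
    exact le_max_left _ _
  · have hpos : 0 < ‖z - p‖ := norm_pos_iff.2 (sub_ne_zero.2 hzp)
    refine le_trans ?_ (le_csSup ⟨_, hup⟩ ⟨‖z - p‖⁻¹ • (z - p), ?_, rfl⟩)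
    · refine le_trans ?_ (le_max_right _ _)
      have hs : suppF F a t (‖z - p‖⁻¹ • (z - p)) ≤ inner ℝ p (‖z - p‖⁻¹ • (z - p)) := by
        refine csSup_le ⟨_, p, h.1, rfl⟩ ?_
        rintro _ ⟨q, hq, rfl⟩
        have h1 := h.2 q hq
        rw [← sub_nonpos, ← inner_sub_left, real_inner_smul_right, real_inner_comm]
        exact mul_nonpos_of_nonneg_of_nonpos (by positivity) h1
      have h2 : (inner ℝ (z - p) (‖z - p‖⁻¹ • (z - p)) : ℝ) = ‖z - p‖ := by
        rw [real_inner_smul_right, real_inner_self_eq_norm_sq]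
        field_simp
      rw [inner_sub_left] at h2
      linarith
    · simp [norm_smul, hpos.ne']

/-- A bound on the variation of the support function is a bound on the variation of `hfun`. -/
theorem hfun_le_add {d : ℕ} {F : Vec d → ℝ → Set (Vec d)}
    (hFne : ∀ x t, (F x t).Nonempty) (hFcomp : ∀ x t, IsCompact (F x t))
    (hFconv : ∀ x t, Convex ℝ (F x t)) {a b z : Vec d} {t e : ℝ} (he : 0 ≤ e)
    (h : ∀ ψ ∈ Metric.sphere (0 : Vec d) 1, |suppF F a t ψ - suppF F b t ψ| ≤ e) :
    hfun F a z t ≤ hfun F b z t + e := by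
  obtain ⟨p, hp⟩ := exists_isProjOn (hFne b t) (hFcomp b t) (hFconv b t) z
  have hpe := hp.hfun_eq (hFcomp b t)
  refine Real.sSup_le ?_ (by rw [hpe]; positivity)
  rintro _ ⟨ψ, hψ, rfl⟩
  have hψ1 : ‖ψ‖ = 1 := by simpa using hψ
  have h1 := (abs_le.1 (h ψ hψ)).1
  have h2 : (inner ℝ p ψ : ℝ) ≤ suppF F b t ψ :=
    le_csSup ((hFcomp b t).image (by fun_prop)).bddAbove ⟨p, hp.1, rfl⟩
  have h3 := real_inner_le_norm (z - p) ψ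
  rw [inner_sub_left, hψ1, mul_one] at h3
  rw [hpe]
  exact max_le (by positivity) (by linarith)

instance isFiniteMeasure_muT (T : ℝ) : IsFiniteMeasure (muT T) := by
  unfold muT
  infer_instance

theorem intervalIntegrable_of_memLp_muT {d : ℕ} {T : ℝ} {q : ℝ≥0∞} (hq : 1 ≤ q) {u : ℝ → Vec d}
    (hu : MemLp u q (muT T)) {t : ℝ} (ht : t ∈ Icc 0 T) : IntervalIntegrable u volume 0 t := by
  have h : IntegrableOn u (Ioc 0 T) volume := (hu.mono_exponent hq).integrable le_rfl
  rw [intervalIntegrable_iff_integrableOn_Ioc_of_le ht.1]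
  exact h.mono_set (Ioc_subset_Ioc_right ht.2)

theorem continuousOn_primitive_of_memLp_muT {d : ℕ} {T : ℝ} (hT : 0 ≤ T) {q : ℝ≥0∞} (hq : 1 ≤ q)
    {u : ℝ → Vec d} (hu : MemLp u q (muT T)) (a : Vec d) :
    ContinuousOn (fun t => a + ∫ τ in (0 : ℝ)..t, u τ) (Icc 0 T) := by
  have h := intervalIntegral.continuousOn_primitive_interval' (a := 0)
    (intervalIntegrable_of_memLp_muT hq hu ⟨hT, le_rfl⟩) left_mem_uIcc
  rw [uIcc_of_le hT] at h
  exact continuousOn_const.add h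

theorem ContinuousOn.aestronglyMeasurable_muT {β : Type*} [TopologicalSpace β]
    [TopologicalSpace.PseudoMetrizableSpace β] {T : ℝ} {y : ℝ → β}
    (hy : ContinuousOn y (Icc 0 T)) : AEStronglyMeasurable y (muT T) :=
  (hy.mono Ioc_subset_Icc_self).aestronglyMeasurable measurableSet_Ioc

theorem ae_muT_of_forall {T : ℝ} {Q : ℝ → Prop} (h : ∀ t ∈ Icc 0 T, Q t) : ∀ᵐ t ∂(muT T), Q t :=
  (ae_restrict_iff' measurableSet_Ioc).2 (ae_of_all _ fun t ht => h t (Ioc_subset_Icc_self ht))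

theorem aestronglyMeasurable_comp_muT {d : ℕ} {T : ℝ} {P : Vec d → Vec d → ℝ → Vec d}
    (hP : Continuous fun w : Vec d × Vec d × ℝ => P w.1 w.2.1 w.2.2) {y u : ℝ → Vec d}
    (hy : ContinuousOn y (Icc 0 T)) (hu : AEStronglyMeasurable u (muT T)) :
    AEStronglyMeasurable (fun t => P (y t) (u t) t) (muT T) :=
  hP.comp_aestronglyMeasurable
    (hy.aestronglyMeasurable_muT.prodMk (hu.prodMk aestronglyMeasurable_id))

/-- The residual of an `L^q` velocity with respect to a continuous family of projections is
`L^q`. -/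
theorem memLp_residual {d : ℕ} {T : ℝ} {P : Vec d → Vec d → ℝ → Vec d}
    (hP : Continuous fun w : Vec d × Vec d × ℝ => P w.1 w.2.1 w.2.2)
    (hmin : ∀ a z w t, ‖w - P a w t‖ ≤ ‖w - P a z t‖) {q : ℝ≥0∞} {y u : ℝ → Vec d}
    (hy : ContinuousOn y (Icc 0 T)) (hu : MemLp u q (muT T)) :
    MemLp (fun t => ‖u t - P (y t) (u t) t‖) q (muT T) := by
  have hc : ContinuousOn (fun t => P (y t) 0 t) (Icc 0 T) :=
    hP.comp_continuousOn (hy.prodMk (continuousOn_const.prodMk continuousOn_id))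
  obtain ⟨B, hB⟩ := isCompact_Icc.exists_bound_of_continuousOn hc
  refine (hu.norm.add (memLp_const B)).mono'
    (hu.1.sub (aestronglyMeasurable_comp_muT hP hy hu.1)).norm (ae_muT_of_forall fun t ht => ?_)
  rw [norm_norm]
  exact (hmin _ 0 _ t).trans ((norm_sub_le _ _).trans (add_le_add_right (hB t ht) _))

/-- Projection of `z` onto the closed ball of radius `r` around `p`. -/
def ballRetract {d : ℕ} (r : ℝ) (p z : Vec d) : Vec d :=
  p + (r / max r ‖z - p‖) • (z - p)

theorem norm_ballRetract_sub_left_le {d : ℕ} {r : ℝ} (hr : 0 ≤ r) (p z : Vec d) :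
    ‖ballRetract r p z - p‖ ≤ r := by
  have hm : 0 ≤ max r ‖z - p‖ := le_max_of_le_left hr
  rw [ballRetract, add_sub_cancel_left, norm_smul, Real.norm_of_nonneg (div_nonneg hr hm),
    div_mul_eq_mul_div]
  exact div_le_of_le_mul₀ hm hr (mul_le_mul_of_nonneg_left (le_max_right _ _) hr)

theorem norm_ballRetract_sub_right_le {d : ℕ} {r e : ℝ} (hr : 0 ≤ r) (he : 0 ≤ e) {p z : Vec d}
    (h : ‖z - p‖ ≤ r + e) : ‖ballRetract r p z - z‖ ≤ e := by
  have heq : ballRetract r p z - z = (r / max r ‖z - p‖ - 1) • (z - p) := by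
    rw [ballRetract, sub_smul, one_smul]
    abel
  rcases le_or_gt ‖z - p‖ r with hle | hlt
  · rcases hr.eq_or_lt with h0 | hpos
    · have : ‖z - p‖ = 0 := le_antisymm (hle.trans h0.ge) (norm_nonneg _)
      rw [heq, norm_smul, this, mul_zero]
      exact he
    · rw [heq, max_eq_left hle, div_self hpos.ne', sub_self, zero_smul, norm_zero]
      exact he
  · have hpos : 0 < ‖z - p‖ := hr.trans_lt hlt
    rw [heq, max_eq_right hlt.le, norm_smul, Real.norm_eq_abs, abs_of_nonpos, neg_sub, sub_mul,
      one_mul, div_mul_cancel₀ _ hpos.ne']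
    · linarith
    · rw [sub_nonpos]
      exact (div_le_one hpos).2 hlt.le

theorem AEStronglyMeasurable.ballRetract {d : ℕ} {μ : Measure ℝ} {r : ℝ → ℝ} {p z : ℝ → Vec d}
    (hr : AEStronglyMeasurable r μ) (hp : AEStronglyMeasurable p μ)
    (hz : AEStronglyMeasurable z μ) :
    AEStronglyMeasurable (fun t => _root_.ballRetract (r t) (p t) (z t)) μ := by
  have hzp := hz.sub hp
  exact hp.add (((hr.aemeasurable.div
    (hr.aemeasurable.max hzp.norm.aemeasurable)).aestronglyMeasurable).smul hzp)

theorem integral_exp_le {l M t : ℝ} (hM : 0 ≤ M) :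
    ∫ τ in (0 : ℝ)..t, l * (M * Real.exp (2 * l * τ)) ≤ M * Real.exp (2 * l * t) / 2 := by
  have h : ∀ τ ∈ uIcc 0 t, HasDerivAt (fun τ => M / 2 * Real.exp (2 * l * τ))
      (l * (M * Real.exp (2 * l * τ))) τ := by
    intro τ _
    have h1 : HasDerivAt (fun τ => 2 * l * τ) (2 * l) τ := by
      simpa using (hasDerivAt_id τ).const_mul (2 * l)
    refine (h1.exp.const_mul (M / 2)).congr_deriv ?_
    ring
  rw [intervalIntegral.integral_eq_sub_of_hasDerivAt h
    (Continuous.intervalIntegrable (by fun_prop) _ _)]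
  have : 0 ≤ M / 2 * Real.exp (2 * l * 0) := by positivity
  linarith

theorem norm_primitive_sub_le {d : ℕ} {T : ℝ} {q : ℝ≥0∞} (hq : 1 ≤ q) {u v : ℝ → Vec d}
    (hu : MemLp u q (muT T)) (hv : MemLp v q (muT T)) {g : ℝ → ℝ} {t : ℝ} (ht : t ∈ Icc 0 T)
    (hg : IntervalIntegrable g volume 0 t) (h : ∀ τ ∈ Icc 0 T, ‖u τ - v τ‖ ≤ g τ) (a : Vec d) :
    ‖(a + ∫ τ in (0 : ℝ)..t, u τ) - (a + ∫ τ in (0 : ℝ)..t, v τ)‖ ≤ ∫ τ in (0 : ℝ)..t, g τ := by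
  rw [add_sub_add_left_eq_sub, ← intervalIntegral.integral_sub
    (intervalIntegrable_of_memLp_muT hq hu ht) (intervalIntegrable_of_memLp_muT hq hv ht)]
  exact intervalIntegral.norm_integral_le_of_norm_le ht.1
    (ae_of_all _ fun τ hτ => h τ ⟨hτ.1.le, hτ.2.trans ht.2⟩) hg

/-- Filippov-type theorem: a trajectory `y` with velocity `v` can be corrected so that the residual
is reduced pointwise by the factor `1 - s`, with a control of the change of the velocity. -/
theorem exists_filippov_correction {d : ℕ} {T : ℝ} (hT : 0 ≤ T) {P : Vec d → Vec d → ℝ → Vec d}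
    (hP : Continuous fun w : Vec d × Vec d × ℝ => P w.1 w.2.1 w.2.2)
    (hmin : ∀ a z w t, ‖w - P a w t‖ ≤ ‖w - P a z t‖) {l : ℝ} (hl : 0 < l)
    (hLip : ∀ t ∈ Icc 0 T, ∀ a b z, ‖z - P a z t‖ ≤ ‖z - P b z t‖ + l * ‖a - b‖)
    {q : ℝ≥0∞} (hq : 1 ≤ q) {y v : ℝ → Vec d} (hv : MemLp v q (muT T))
    (hy : ∀ t ∈ Icc 0 T, y t = y 0 + ∫ τ in (0 : ℝ)..t, v τ) {s : ℝ} (hs : s ∈ Icc (0 : ℝ) 1) :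
    ∃ u : ℝ → Vec d, MemLp u q (muT T) ∧ ∀ t ∈ Icc 0 T,
      ‖u t - P (y 0 + ∫ τ in (0 : ℝ)..t, u τ) (u t) t‖ ≤ (1 - s) * ‖v t - P (y t) (v t) t‖ ∧
      ‖u t - v t‖ ≤ s * ‖v t - P (y t) (v t) t‖ +
        2 * l * Real.exp (2 * l * T) * (s * ∫ τ, ‖v τ - P (y τ) (v τ) τ‖ ∂(muT T)) := by
  have hycont : ContinuousOn y (Icc 0 T) :=
    (continuousOn_primitive_of_memLp_muT hT hq hv (y 0)).congr hy
  set ρ : ℝ → ℝ := fun t => ‖v t - P (y t) (v t) t‖ with hρdef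
  have hρ : MemLp ρ q (muT T) := memLp_residual hP hmin hycont hv
  have hρ0 : ∀ t, 0 ≤ ρ t := fun t => norm_nonneg _
  have hρint : IntegrableOn ρ (Ioc 0 T) volume := (hρ.mono_exponent hq).integrable le_rfl
  set M : ℝ := s * ∫ τ, ρ τ ∂(muT T) with hMdef
  have hM : 0 ≤ M := mul_nonneg hs.1 (integral_nonneg hρ0)
  set r : ℝ → ℝ := fun t => (1 - s) * ρ t with hrdef
  have hr0 : ∀ t, 0 ≤ r t := fun t => mul_nonneg (sub_nonneg.2 hs.2) (hρ0 t)
  have hr : AEStronglyMeasurable r (muT T) := hρ.1.const_mul _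
  let Y : (ℝ → Vec d) → ℝ → Vec d := fun u t => y 0 + ∫ τ in (0 : ℝ)..t, u τ
  let U : ℕ → ℝ → Vec d := fun k => Nat.rec v
    (fun _ u t => ballRetract (r t) (P (Y u t) (u t) t) (u t)) k
  have hU0 : U 0 = v := rfl
  have hUs : ∀ k t, U (k + 1) t = ballRetract (r t) (P (Y (U k) t) (U k t) t) (U k t) :=
    fun _ _ => rfl
  have hstep0 : ∀ t ∈ Icc 0 T, ‖U 1 t - U 0 t‖ ≤ s * ρ t := by
    intro t ht
    rw [← zero_add 1, hUs]
    refine norm_ballRetract_sub_right_le (hr0 t) (mul_nonneg hs.1 (hρ0 t)) ?_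
    have : Y (U 0) t = y t := (hy t ht).symm
    rw [this, hU0]
    exact le_of_eq (by rw [hrdef, hρdef]; ring)
  have hres : ∀ k t, ‖U (k + 1) t - P (Y (U k) t) (U (k + 1) t) t‖ ≤ r t := by
    intro k t
    refine (hmin _ (U k t) _ t).trans ?_
    rw [hUs]
    exact norm_ballRetract_sub_left_le (hr0 t) _ _
  have hstep : ∀ k, ∀ t ∈ Icc 0 T,
      ‖U (k + 2) t - U (k + 1) t‖ ≤ l * ‖Y (U (k + 1)) t - Y (U k) t‖ := by
    intro k t ht
    rw [hUs (k + 1)]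
    refine norm_ballRetract_sub_right_le (hr0 t) (by positivity) ?_
    exact (hLip t ht _ (Y (U k) t) _).trans (add_le_add_left (hres k t) _)
  have hULp : ∀ k, MemLp (U k) q (muT T) := by
    intro k
    induction k with
    | zero => exact hv
    | succ k ih =>
      have hYc := continuousOn_primitive_of_memLp_muT hT hq ih (y 0)
      have hP' := aestronglyMeasurable_comp_muT hP hYc ih.1
      have h1 : MemLp (fun t => ‖U k t - P (Y (U k) t) (U k t) t‖) q (muT T) :=
        memLp_residual hP hmin hYc ih
      have hm : AEStronglyMeasurable (U (k + 1)) (muT T) :=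
        AEStronglyMeasurable.ballRetract hr hP' ih.1
      have h2 : MemLp (fun t => U (k + 1) t - U k t) q (muT T) := by
        refine h1.mono' (hm.sub ih.1) (ae_of_all _ fun t => ?_)
        rw [hUs]
        exact norm_ballRetract_sub_right_le (hr0 t) (norm_nonneg _)
          (le_add_of_nonneg_left (hr0 t))
      have h3 := h2.add ih
      refine (memLp_congr_ae (ae_of_all _ fun t => ?_)).1 h3
      simp
  have hYstep : ∀ k, ∀ t ∈ Icc 0 T,
      ‖Y (U (k + 1)) t - Y (U k) t‖ ≤ M / 2 ^ k * Real.exp (2 * l * t) := by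
    intro k
    induction k with
    | zero =>
      intro t ht
      have hsub : Ioc 0 t ⊆ Ioc 0 T := Ioc_subset_Ioc_right ht.2
      have hi : IntervalIntegrable (fun τ => s * ρ τ) volume 0 t := by
        rw [intervalIntegrable_iff_integrableOn_Ioc_of_le ht.1]
        exact (hρint.mono_set hsub).const_mul s
      refine (norm_primitive_sub_le hq (hULp 1) (hULp 0) ht hi hstep0 (y 0)).trans ?_
      rw [intervalIntegral.integral_const_mul, intervalIntegral.integral_of_le ht.1]
      have h1 : ∫ τ in Ioc 0 t, ρ τ ≤ ∫ τ, ρ τ ∂(muT T) :=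
        setIntegral_mono_set hρint (ae_of_all _ hρ0) hsub.eventuallyLE
      have h2 : 1 ≤ Real.exp (2 * l * t) :=
        Real.one_le_exp (mul_nonneg (by positivity) ht.1)
      calc s * ∫ τ in Ioc 0 t, ρ τ ≤ M := mul_le_mul_of_nonneg_left h1 hs.1
        _ ≤ M * Real.exp (2 * l * t) := le_mul_of_one_le_right hM h2
        _ = M / 2 ^ 0 * Real.exp (2 * l * t) := by simp
    | succ k ih =>
      intro t ht
      have hi : IntervalIntegrable (fun τ => l * (M / 2 ^ k * Real.exp (2 * l * τ))) volume 0 t :=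
        Continuous.intervalIntegrable (by fun_prop) _ _
      refine (norm_primitive_sub_le hq (hULp (k + 2)) (hULp (k + 1)) ht hi
        (fun τ hτ => (hstep k τ hτ).trans (mul_le_mul_of_nonneg_left (ih τ hτ) hl.le))
        (y 0)).trans ?_
      refine (integral_exp_le (l := l) (by positivity)).trans_eq ?_
      rw [pow_succ]
      ring
  set C : ℝ := 2 * l * Real.exp (2 * l * T) * M with hCdef
  have hgeom : ∀ t ∈ Icc 0 T, ∀ k, dist (U (k + 1) t) (U (k + 1 + 1) t) ≤ C / 2 / 2 ^ k := by
    intro t ht k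
    rw [dist_comm, dist_eq_norm]
    refine (hstep k t ht).trans ?_
    have h1 : Real.exp (2 * l * t) ≤ Real.exp (2 * l * T) :=
      Real.exp_le_exp.2 (mul_le_mul_of_nonneg_left ht.2 (by positivity))
    calc l * ‖Y (U (k + 1)) t - Y (U k) t‖
        ≤ l * (M / 2 ^ k * Real.exp (2 * l * T)) :=
          mul_le_mul_of_nonneg_left ((hYstep k t ht).trans
            (mul_le_mul_of_nonneg_left h1 (by positivity))) hl.le
      _ = C / 2 / 2 ^ k := by rw [hCdef]; ring
  have hlim : ∀ t ∈ Icc 0 T, ∃ a, Tendsto (fun k => U (k + 1) t) atTop (𝓝 a) := fun t ht =>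
    cauchySeq_tendsto_of_complete (cauchySeq_of_le_geometric_two (hgeom t ht))
  choose! u hu using hlim
  have hdist : ∀ t ∈ Icc 0 T, ∀ k, ‖U (k + 1) t - u t‖ ≤ C / 2 ^ k := fun t ht k => by
    rw [← dist_eq_norm]
    exact dist_le_of_le_geometric_two_of_tendsto (hgeom t ht) (hu t ht) k
  have hum : AEStronglyMeasurable u (muT T) :=
    aestronglyMeasurable_of_tendsto_ae atTop (fun k => (hULp (k + 1)).1) (ae_muT_of_forall hu)
  have hbound : ∀ t ∈ Icc 0 T, ‖u t - v t‖ ≤ s * ρ t + C := by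
    intro t ht
    have h1 := hdist t ht 0
    rw [pow_zero, div_one, norm_sub_rev] at h1
    have h2 := hstep0 t ht
    have h3 := norm_sub_le_norm_sub_add_norm_sub (u t) (U 1 t) (v t)
    rw [hU0] at h2
    exact h3.trans (by rw [add_comm]; exact add_le_add h2 h1)
  have huLp : MemLp u q (muT T) := by
    have h2 : MemLp (fun t => u t - v t) q (muT T) :=
      ((hρ.const_mul s).add (memLp_const C)).mono' (hum.sub hv.1) (ae_muT_of_forall hbound)
    refine (memLp_congr_ae (ae_of_all _ fun t => ?_)).1 (h2.add hv)
    simp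
  refine ⟨u, huLp, fun t ht => ⟨?_, hbound t ht⟩⟩
  have hYlim : Tendsto (fun k => Y (U (k + 1)) t) atTop (𝓝 (Y u t)) := by
    rw [tendsto_iff_norm_sub_tendsto_zero]
    refine squeeze_zero (g := fun k : ℕ => t * (C / 2 ^ k)) (fun _ => norm_nonneg _)
      (fun k => ?_) ?_
    · refine (norm_primitive_sub_le hq (hULp (k + 1)) huLp ht
        (g := fun _ => C / 2 ^ k) (by simp) (fun τ hτ => hdist τ hτ k) (y 0)).trans_eq ?_
      simp [mul_div_assoc]
    · have h1 : Tendsto (fun k : ℕ => (1 / 2 : ℝ) ^ k) atTop (𝓝 0) :=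
        tendsto_pow_atTop_nhds_zero_of_lt_one (by norm_num) (by norm_num)
      have h2 := h1.const_mul (t * C)
      rw [mul_zero] at h2
      refine h2.congr fun k => ?_
      rw [one_div, inv_pow]
      ring
  have hYlim' : Tendsto (fun k => Y (U k) t) atTop (𝓝 (Y u t)) :=
    (tendsto_add_atTop_iff_nat 1).1 hYlim
  have hlimres : Tendsto (fun k => ‖U (k + 1) t - P (Y (U k) t) (U (k + 1) t) t‖) atTop
      (𝓝 ‖u t - P (Y u t) (u t) t‖) :=
    ((hu t ht).sub ((hP.tendsto (Y u t, u t, t)).comp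
      (hYlim'.prodMk_nhds ((hu t ht).prodMk_nhds tendsto_const_nhds)))).norm
  exact le_of_tendsto' hlimres fun k => hres k t

/-- A family of functions with jointly continuous gradient is equi-Lipschitz on balls, uniformly
over a compact set of parameters. -/
theorem exists_lipschitz_of_continuousOn_gradient {d : ℕ} {Y : Type*} [TopologicalSpace Y]
    {S : Set Y} (hS : IsCompact S) {f : Vec d → Y → ℝ} {g : Vec d → Y → Vec d}
    (hg : ContinuousOn (fun w : Vec d × Y => g w.1 w.2) (univ ×ˢ S))
    (hfg : ∀ y ∈ S, ∀ a, HasGradientAt (fun a' => f a' y) (g a y) a) (R : ℝ) :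
    ∃ L : ℝ, 0 < L ∧ ∀ y ∈ S, ∀ a ∈ Metric.closedBall (0 : Vec d) R,
      ∀ b ∈ Metric.closedBall (0 : Vec d) R, |f a y - f b y| ≤ L * ‖a - b‖ := by
  obtain ⟨B, hB⟩ := ((isCompact_closedBall (0 : Vec d) R).prod hS).exists_bound_of_continuousOn
    (hg.mono (prod_mono (subset_univ _) subset_rfl))
  refine ⟨max B 1, lt_max_of_lt_right one_pos, fun y hy a ha b hb => ?_⟩
  refine Convex.norm_image_sub_le_of_norm_hasFDerivWithin_le (𝕜 := ℝ) (f := fun a' => f a' y)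
    (fun x _ => (hfg y hy x).hasFDerivAt.hasFDerivWithinAt) (fun x hx => ?_)
    (convex_closedBall (0 : Vec d) R) hb ha
  rw [LinearIsometryEquiv.norm_map]
  exact (hB (x, y) ⟨hx, hy⟩).trans (le_max_left _ _)

/-- The objective functional is Lipschitz for the uniform distance on bounded sets. -/
theorem exists_lipschitz_IvalDI {d : ℕ} {T : ℝ} (hT : 0 ≤ T) {θ : Vec d → ℝ → ℝ} {ζ : Vec d → ℝ}
    (hζ : LocallyLipschitz ζ) {θx : Vec d → ℝ → Vec d}
    (hθc : ContinuousOn (fun w : Vec d × ℝ => θ w.1 w.2) (Set.univ ×ˢ Set.Icc 0 T))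
    (hθx : ∀ t : ℝ, t ∈ Set.Icc 0 T → ∀ a : Vec d,
      HasGradientAt (fun a' => θ a' t) (θx a t) a)
    (hθxc : ContinuousOn (fun w : Vec d × ℝ => θx w.1 w.2) (Set.univ ×ˢ Set.Icc 0 T)) (R : ℝ) :
    ∃ L : ℝ, 0 ≤ L ∧ ∀ z w : TrajDI d, ContinuousOn z.1 (Icc 0 T) → ContinuousOn w.1 (Icc 0 T) →
      (∀ t ∈ Icc 0 T, ‖z.1 t‖ ≤ R) → (∀ t ∈ Icc 0 T, ‖w.1 t‖ ≤ R) →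
      ∀ e, (∀ t ∈ Icc 0 T, ‖w.1 t - z.1 t‖ ≤ e) → |IvalDI T θ ζ w - IvalDI T θ ζ z| ≤ L * e := by
  obtain ⟨L₁, hL₁, h₁⟩ := exists_lipschitz_of_continuousOn_gradient isCompact_Icc hθxc hθx R
  obtain ⟨L₂, h₂⟩ := hζ.locallyLipschitzOn.exists_lipschitzOnWith_of_compact
    (isCompact_closedBall (0 : Vec d) R)
  refine ⟨T * L₁ + L₂, by positivity, fun z w hz hw hzR hwR e he => ?_⟩
  have hint : ∀ y : ℝ → Vec d, ContinuousOn y (Icc 0 T) →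
      IntegrableOn (fun t => θ (y t) t) (Ioc 0 T) := fun y hy =>
    ((hθc.comp (hy.prodMk continuousOn_id) fun t ht => ⟨mem_univ _, ht⟩).integrableOn_Icc).mono_set
      Ioc_subset_Icc_self
  have hb : ∀ y : Vec d, ‖y‖ ≤ R → y ∈ Metric.closedBall (0 : Vec d) R := fun y hy => by
    simpa using hy
  have hTm : T ∈ Icc 0 T := ⟨hT, le_rfl⟩
  have h3 : |(∫ t in Ioc (0 : ℝ) T, θ (w.1 t) t) - ∫ t in Ioc (0 : ℝ) T, θ (z.1 t) t|
      ≤ T * L₁ * e := by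
    rw [← integral_sub (hint _ hw) (hint _ hz), ← Real.norm_eq_abs]
    refine (norm_setIntegral_le_of_norm_le_const (C := L₁ * e) (by simp) fun t ht => ?_).trans_eq ?_
    · have ht' := Ioc_subset_Icc_self ht
      exact (h₁ t ht' _ (hb _ (hwR t ht')) _ (hb _ (hzR t ht'))).trans
        (mul_le_mul_of_nonneg_left (he t ht') hL₁.le)
    · rw [Real.volume_real_Ioc_of_le hT]
      ring
  have h4 : |ζ (w.1 T) - ζ (z.1 T)| ≤ L₂ * e := by
    have := h₂.dist_le_mul _ (hb _ (hwR T hTm)) _ (hb _ (hzR T hTm))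
    rw [Real.dist_eq, dist_eq_norm] at this
    exact this.trans (mul_le_mul_of_nonneg_left (he T hTm) L₂.2)
  have h5 : IvalDI T θ ζ w - IvalDI T θ ζ z =
      ((∫ t in Ioc (0 : ℝ) T, θ (w.1 t) t) - ∫ t in Ioc (0 : ℝ) T, θ (z.1 t) t)
        + (ζ (w.1 T) - ζ (z.1 T)) := by
    unfold IvalDI
    ring
  rw [h5, add_mul]
  exact (abs_add_le _ _).trans (add_le_add h3 h4)

theorem exists_integral_norm_le_eLpNorm {d : ℕ} (T : ℝ) {q : ℝ≥0∞} (hq : 1 ≤ q) :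
    ∃ κ : ℝ, 0 ≤ κ ∧ ∀ f : ℝ → Vec d, MemLp f q (muT T) →
      ∫ t, ‖f t‖ ∂(muT T) ≤ κ * (eLpNorm f q (muT T)).toReal := by
  refine ⟨(muT T univ ^ (1 / (1 : ℝ≥0∞).toReal - 1 / q.toReal)).toReal, ENNReal.toReal_nonneg,
    fun f hf => ?_⟩
  have h1 := eLpNorm_le_eLpNorm_mul_rpow_measure_univ (μ := muT T) hq hf.1
  have hexp : 0 ≤ 1 / (1 : ℝ≥0∞).toReal - 1 / q.toReal := by
    by_cases hqt : q = ⊤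
    · simp [hqt]
    · have : 1 ≤ q.toReal := by
        simpa using (ENNReal.toReal_le_toReal ENNReal.one_ne_top hqt).2 hq
      rw [ENNReal.toReal_one, div_one, sub_nonneg]
      exact div_le_one_of_le₀ this (zero_le_one.trans this)
  have hfin : muT T univ ^ (1 / (1 : ℝ≥0∞).toReal - 1 / q.toReal) ≠ ⊤ :=
    ENNReal.rpow_ne_top_of_nonneg hexp (measure_ne_top _ _)
  rw [integral_norm_eq_lintegral_enorm hf.1, ← eLpNorm_one_eq_lintegral_enorm,
    mul_comm, ← ENNReal.toReal_mul]
  exact ENNReal.toReal_mono (ENNReal.mul_ne_top hf.eLpNorm_ne_top hfin) h1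

theorem toReal_eLpNorm_le_of_norm_le {β : Type*} [NormedAddCommGroup β] {T : ℝ} {q : ℝ≥0∞}
    (hq : 1 ≤ q) {f : ℝ → β} {ρ : ℝ → ℝ} (hρ : MemLp ρ q (muT T)) {a b : ℝ} (ha : 0 ≤ a)
    (hb : 0 ≤ b) (h : ∀ t ∈ Icc 0 T, ‖f t‖ ≤ a * ρ t + b) :
    (eLpNorm f q (muT T)).toReal ≤ a * (eLpNorm ρ q (muT T)).toReal +
      b * (eLpNorm (fun _ : ℝ => (1 : ℝ)) q (muT T)).toReal := by
  have h1 : eLpNorm f q (muT T) ≤ eLpNorm (a • ρ + b • fun _ : ℝ => (1 : ℝ)) q (muT T) := by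
    refine eLpNorm_mono_ae_real (ae_muT_of_forall fun t ht => ?_)
    simpa using h t ht
  have hone : MemLp (fun _ : ℝ => (1 : ℝ)) q (muT T) := memLp_const 1
  have h2 := h1.trans (eLpNorm_add_le (hρ.1.const_smul a) (hone.1.const_smul b) hq)
  rw [eLpNorm_const_smul, eLpNorm_const_smul] at h2
  have h3 : ‖a‖ₑ * eLpNorm ρ q (muT T) ≠ ⊤ := ENNReal.mul_ne_top (by simp) hρ.eLpNorm_ne_top
  have h4 : ‖b‖ₑ * eLpNorm (fun _ : ℝ => (1 : ℝ)) q (muT T) ≠ ⊤ :=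
    ENNReal.mul_ne_top (by simp) hone.eLpNorm_ne_top
  refine (ENNReal.toReal_mono (ENNReal.add_ne_top.2 ⟨h3, h4⟩) h2).trans_eq ?_
  rw [ENNReal.toReal_add h3 h4, ENNReal.toReal_mul, ENNReal.toReal_mul, toReal_enorm, toReal_enorm,
    Real.norm_of_nonneg ha, Real.norm_of_nonneg hb]

section Trajectories

variable {d : ℕ} {T p : ℝ} {x₀ : Vec d}

theorem continuousOn_of_mem_AsetDI (hT : 0 ≤ T) (hp : 1 ≤ ENNReal.ofReal p) {z : TrajDI d}
    (hz : z ∈ AsetDI T p x₀) : ContinuousOn z.1 (Icc 0 T) :=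
  (continuousOn_primitive_of_memLp_muT hT hp hz.1.2.2 (z.1 0)).congr hz.1.2.1

theorem memLp_of_continuousOn_Icc {q : ℝ≥0∞} {y : ℝ → Vec d} (hy : ContinuousOn y (Icc 0 T)) :
    MemLp y q (muT T) := by
  obtain ⟨B, hB⟩ := isCompact_Icc.exists_bound_of_continuousOn hy
  exact MemLp.of_bound hy.aestronglyMeasurable_muT B (ae_muT_of_forall hB)

/-- The uniform distance is controlled by the distance in `W^{1,p}`. -/
theorem norm_sub_le_distDI (hp : 1 ≤ ENNReal.ofReal p) {κ : ℝ} (hκ : 0 ≤ κ)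
    (hHol : ∀ f : ℝ → Vec d, MemLp f (ENNReal.ofReal p) (muT T) →
      ∫ t, ‖f t‖ ∂(muT T) ≤ κ * (eLpNorm f (ENNReal.ofReal p) (muT T)).toReal)
    {z w : TrajDI d} (hz : z ∈ AsetDI T p x₀) (hw : w ∈ AsetDI T p x₀) {t : ℝ}
    (ht : t ∈ Icc 0 T) : ‖w.1 t - z.1 t‖ ≤ κ * distDI T p w z := by
  have hd : MemLp (fun τ => w.2 τ - z.2 τ) (ENNReal.ofReal p) (muT T) := hw.1.2.2.sub hz.1.2.2
  have hi : IntegrableOn (fun τ => ‖w.2 τ - z.2 τ‖) (Ioc 0 T) volume :=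
    ((hd.mono_exponent hp).integrable le_rfl).norm
  have hsub : Ioc 0 t ⊆ Ioc 0 T := Ioc_subset_Ioc_right ht.2
  have hi' : IntervalIntegrable (fun τ => ‖w.2 τ - z.2 τ‖) volume 0 t := by
    rw [intervalIntegrable_iff_integrableOn_Ioc_of_le ht.1]
    exact hi.mono_set hsub
  rw [hz.1.2.1 t ht, hw.1.2.1 t ht, hz.2, hw.2]
  refine (norm_primitive_sub_le hp hw.1.2.2 hz.1.2.2 ht hi' (fun _ _ => le_rfl) x₀).trans ?_
  rw [intervalIntegral.integral_of_le ht.1]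
  refine (setIntegral_mono_set hi (ae_of_all _ fun _ => norm_nonneg _) hsub.eventuallyLE).trans ?_
  refine (hHol _ hd).trans (mul_le_mul_of_nonneg_left ?_ hκ)
  exact le_add_of_nonneg_left ENNReal.toReal_nonneg

theorem norm_le_of_mem_AsetDI (hp : 1 ≤ ENNReal.ofReal p) {κ : ℝ} (hκ : 0 ≤ κ)
    (hHol : ∀ f : ℝ → Vec d, MemLp f (ENNReal.ofReal p) (muT T) →
      ∫ t, ‖f t‖ ∂(muT T) ≤ κ * (eLpNorm f (ENNReal.ofReal p) (muT T)).toReal)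
    {z : TrajDI d} (hz : z ∈ AsetDI T p x₀) {t : ℝ} (ht : t ∈ Icc 0 T) :
    ‖z.1 t‖ ≤ ‖x₀‖ + κ * normDI T p z := by
  have hi : IntegrableOn z.2 (Ioc 0 T) volume :=
    (hz.1.2.2.mono_exponent hp).integrable le_rfl
  have hsub : Ioc 0 t ⊆ Ioc 0 T := Ioc_subset_Ioc_right ht.2
  rw [hz.1.2.1 t ht, hz.2]
  refine (norm_add_le _ _).trans (add_le_add_right ?_ _)
  rw [intervalIntegral.integral_of_le ht.1]
  refine (norm_integral_le_integral_norm _).trans ?_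
  refine (setIntegral_mono_set hi.norm (ae_of_all _ fun _ => norm_nonneg _)
    hsub.eventuallyLE).trans ?_
  refine (hHol _ hz.1.2.2).trans (mul_le_mul_of_nonneg_left ?_ hκ)
  exact le_add_of_nonneg_left ENNReal.toReal_nonneg

theorem distDI_nonneg (z w : TrajDI d) : 0 ≤ distDI T p z w :=
  add_nonneg ENNReal.toReal_nonneg ENNReal.toReal_nonneg

theorem toReal_eLpNorm_sub_le {q : ℝ≥0∞} (hq : 1 ≤ q) {f g h : ℝ → Vec d}
    (hf : MemLp f q (muT T)) (hg : MemLp g q (muT T)) (hh : MemLp h q (muT T)) :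
    (eLpNorm (fun t => f t - h t) q (muT T)).toReal ≤
      (eLpNorm (fun t => f t - g t) q (muT T)).toReal +
        (eLpNorm (fun t => g t - h t) q (muT T)).toReal := by
  have heq : (fun t => f t - h t) = (fun t => f t - g t) + fun t => g t - h t := by
    ext1 t
    simp
  have h1 : MemLp (fun t => f t - g t) q (muT T) := hf.sub hg
  have h2 : MemLp (fun t => g t - h t) q (muT T) := hg.sub hh
  rw [heq, ← ENNReal.toReal_add h1.eLpNorm_ne_top h2.eLpNorm_ne_top]
  exact ENNReal.toReal_mono (ENNReal.add_ne_top.2 ⟨h1.eLpNorm_ne_top, h2.eLpNorm_ne_top⟩)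
    (eLpNorm_add_le h1.1 h2.1 hq)

theorem distDI_triangle (hT : 0 ≤ T) (hp : 1 ≤ ENNReal.ofReal p) {x y z : TrajDI d}
    (hx : x ∈ AsetDI T p x₀) (hy : y ∈ AsetDI T p x₀) (hz : z ∈ AsetDI T p x₀) :
    distDI T p x z ≤ distDI T p x y + distDI T p y z := by
  have h1 := toReal_eLpNorm_sub_le hp
    (memLp_of_continuousOn_Icc (continuousOn_of_mem_AsetDI hT hp hx))
    (memLp_of_continuousOn_Icc (continuousOn_of_mem_AsetDI hT hp hy))
    (memLp_of_continuousOn_Icc (continuousOn_of_mem_AsetDI hT hp hz))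
  have h2 := toReal_eLpNorm_sub_le hp hx.1.2.2 hy.1.2.2 hz.1.2.2
  unfold distDI
  linarith

theorem ae_eq_of_toReal_eLpNorm_sub_eq_zero {q : ℝ≥0∞} (hq : q ≠ 0) {f g : ℝ → Vec d}
    (hf : MemLp f q (muT T)) (hg : MemLp g q (muT T))
    (h : (eLpNorm (fun t => f t - g t) q (muT T)).toReal = 0) : f =ᵐ[muT T] g := by
  have hfg : MemLp (fun t => f t - g t) q (muT T) := hf.sub hg
  rw [ENNReal.toReal_eq_zero_iff, or_iff_left hfg.eLpNorm_ne_top,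
    eLpNorm_eq_zero_iff hfg.1 hq] at h
  filter_upwards [h] with t ht
  exact sub_eq_zero.1 ht

theorem phiDI_eq_of_distDI_eq_zero (hT : 0 ≤ T) (hp : 1 ≤ ENNReal.ofReal p)
    (F : Vec d → ℝ → Set (Vec d)) {z w : TrajDI d}
    (hz : z ∈ AsetDI T p x₀) (hw : w ∈ AsetDI T p x₀) (h : distDI T p w z = 0) :
    phiDI T p F w.1 w.2 = phiDI T p F z.1 z.2 := by
  have hp0 : ENNReal.ofReal p ≠ 0 := (one_pos.trans_le hp).ne'
  obtain ⟨h1, h2⟩ := (add_eq_zero_iff_of_nonneg ENNReal.toReal_nonneg ENNReal.toReal_nonneg).1 h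
  refine eLpNorm_congr_ae ?_
  filter_upwards [ae_eq_of_toReal_eLpNorm_sub_eq_zero hp0
    (memLp_of_continuousOn_Icc (continuousOn_of_mem_AsetDI hT hp hw))
    (memLp_of_continuousOn_Icc (continuousOn_of_mem_AsetDI hT hp hz)) h1,
    ae_eq_of_toReal_eLpNorm_sub_eq_zero hp0 hw.1.2.2 hz.1.2.2 h2] with t ht1 ht2
  rw [ht1, ht2]

end Trajectories

section Penalty

variable {d : ℕ} {T p : ℝ} {x₀ : Vec d} {F : Vec d → ℝ → Set (Vec d)}
  {P : Vec d → Vec d → ℝ → Vec d}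

theorem memLp_hfun (hT : 0 ≤ T) (hp : 1 ≤ ENNReal.ofReal p)
    (hFcomp : ∀ x t, IsCompact (F x t)) (hPF : ∀ a z t, IsProjOn (F a t) z (P a z t))
    (hP : Continuous fun w : Vec d × Vec d × ℝ => P w.1 w.2.1 w.2.2) {z : TrajDI d}
    (hz : z ∈ AsetDI T p x₀) :
    MemLp (fun t => hfun F (z.1 t) (z.2 t) t) (ENNReal.ofReal p) (muT T) := by
  simp_rw [fun a z t => (hPF a z t).hfun_eq (hFcomp a t)]
  exact memLp_residual hP (fun a z w t => (hPF a w t).norm_sub_le (hPF a z t).1)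
    (continuousOn_of_mem_AsetDI hT hp hz) hz.1.2.2

theorem mem_OsetDI_iff (hT : 0 ≤ T) (hp : 1 ≤ ENNReal.ofReal p)
    (hFcomp : ∀ x t, IsCompact (F x t)) (hPF : ∀ a z t, IsProjOn (F a t) z (P a z t))
    (hP : Continuous fun w : Vec d × Vec d × ℝ => P w.1 w.2.1 w.2.2) {z : TrajDI d} :
    z ∈ OsetDI T p x₀ F ↔ z ∈ AsetDI T p x₀ ∧ (phiDI T p F z.1 z.2).toReal = 0 := by
  refine and_congr_right fun hz => ?_
  have hm := memLp_hfun hT hp hFcomp hPF hP hz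
  rw [phiDI, ENNReal.toReal_eq_zero_iff, or_iff_left hm.eLpNorm_ne_top,
    eLpNorm_eq_zero_iff hm.1 (one_pos.trans_le hp).ne']
  refine eventually_congr (ae_of_all _ fun t => ?_)
  have h := hPF (z.1 t) (z.2 t) t
  change _ ↔ hfun F (z.1 t) (z.2 t) t = 0
  rw [h.hfun_eq (hFcomp _ _), norm_eq_zero, sub_eq_zero]
  constructor
  · intro hmem
    have := h.norm_sub_le hmem
    rw [sub_self, norm_zero, norm_le_zero_iff] at this
    exact sub_eq_zero.1 this
  · intro heq
    rw [heq]
    exact h.1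

theorem PhiDI_eq_coe {θ : Vec d → ℝ → ℝ} {ζ : Vec d → ℝ} {z : TrajDI d}
    (h : phiDI T p F z.1 z.2 ≠ ⊤) (lam : ℝ) :
    PhiDI T p θ ζ F lam z =
      ((IvalDI T θ ζ z + lam * (phiDI T p F z.1 z.2).toReal : ℝ) : EReal) := by
  rw [PhiDI, EReal.coe_add, EReal.coe_mul, EReal.coe_ennreal_toReal h]

/-- Truncating the state variable to a ball makes the projection residual Lipschitz in the state. -/
theorem exists_truncated_residual_lipschitz
    (hFne : ∀ x t, (F x t).Nonempty) (hFcomp : ∀ x t, IsCompact (F x t))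
    (hFconv : ∀ x t, Convex ℝ (F x t)) (hPF : ∀ a z t, IsProjOn (F a t) z (P a z t))
    (hP : Continuous fun w : Vec d × Vec d × ℝ => P w.1 w.2.1 w.2.2)
    {sGrad : Vec d → ℝ → Vec d → Vec d}
    (hsG : ∀ (t : ℝ), t ∈ Set.Icc 0 T → ∀ ψ ∈ Metric.sphere (0 : Vec d) 1, ∀ x : Vec d,
      HasGradientAt (fun a => suppF F a t ψ) (sGrad x t ψ) x)
    (hsGc : ContinuousOn (fun w : Vec d × ℝ × Vec d => sGrad w.1 w.2.1 w.2.2)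
      (Set.univ ×ˢ Set.Icc 0 T ×ˢ Metric.sphere (0 : Vec d) 1)) {R : ℝ} (hR : 0 ≤ R) :
    ∃ (Q : Vec d → Vec d → ℝ → Vec d) (l : ℝ), 0 < l ∧
      (Continuous fun w : Vec d × Vec d × ℝ => Q w.1 w.2.1 w.2.2) ∧
      (∀ a z w t, ‖w - Q a w t‖ ≤ ‖w - Q a z t‖) ∧
      (∀ t ∈ Icc 0 T, ∀ a b z : Vec d, ‖z - Q a z t‖ ≤ ‖z - Q b z t‖ + l * ‖a - b‖) ∧
      ∀ a z t, ‖a‖ ≤ R → ‖z - Q a z t‖ = hfun F a z t := by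
  obtain ⟨l, hl, hlip⟩ := exists_lipschitz_of_continuousOn_gradient
    (f := fun a (y : ℝ × Vec d) => suppF F a y.1 y.2)
    (g := fun a (y : ℝ × Vec d) => sGrad a y.1 y.2)
    (isCompact_Icc.prod (isCompact_sphere (0 : Vec d) 1)) hsGc
    (fun y hy a => hsG y.1 hy.1 y.2 hy.2 a) R
  have hball := exists_isProjOn (E := Vec d) (K := Metric.closedBall 0 (R))
    (Metric.nonempty_closedBall.2 hR) (isCompact_closedBall _ _)
    (convex_closedBall _ _)
  choose π hπ using hball
  have hπlip : ∀ a b, ‖π a - π b‖ ≤ ‖a - b‖ := fun a b =>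
    (hπ b).norm_sub_le_norm_sub (hπ a)
  have hπid : ∀ a, ‖a‖ ≤ R → π a = a := by
    intro a ha
    have := (hπ a).norm_sub_le (q := a) (by simpa using ha)
    rw [sub_self, norm_zero, norm_le_zero_iff] at this
    exact (sub_eq_zero.1 this).symm
  have hπc : Continuous π :=
    (LipschitzWith.of_dist_le_mul (K := 1) fun a b => by
      simpa [dist_eq_norm] using hπlip a b).continuous
  have hP' : Continuous fun w : Vec d × Vec d × ℝ => P (π w.1) w.2.1 w.2.2 :=
    hP.comp ((hπc.comp continuous_fst).prodMk continuous_snd)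
  have hmin : ∀ a z w t, ‖w - P (π a) w t‖ ≤ ‖w - P (π a) z t‖ := fun a z w t =>
    (hPF _ w t).norm_sub_le (hPF _ z t).1
  have hh : ∀ a z t, hfun F a z t = ‖z - P a z t‖ := fun a z t => (hPF a z t).hfun_eq (hFcomp a t)
  have hLip : ∀ t ∈ Icc 0 T, ∀ a b z : Vec d,
      ‖z - P (π a) z t‖ ≤ ‖z - P (π b) z t‖ + l * ‖a - b‖ := by
    intro t ht a b z
    rw [← hh, ← hh]
    refine hfun_le_add hFne hFcomp hFconv (by positivity) fun ψ hψ => ?_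
    exact (hlip (t, ψ) ⟨ht, hψ⟩ _ (hπ a).1 _ (hπ b).1).trans
      (mul_le_mul_of_nonneg_left (hπlip a b) hl.le)
  exact ⟨fun a z t => P (π a) z t, l, hl, hP', hmin, hLip, fun a z t ha => by
    simp only [hπid a ha, hh]⟩

/-- Near a trajectory with a small penalty term there are trajectories along which the penalty term
decreases at least proportionally to the distance. -/
theorem exists_penalty_decrease (hT : 0 < T) (hp : 1 ≤ ENNReal.ofReal p)
    (hFne : ∀ x t, (F x t).Nonempty) (hFcomp : ∀ x t, IsCompact (F x t))
    (hFconv : ∀ x t, Convex ℝ (F x t)) (hPF : ∀ a z t, IsProjOn (F a t) z (P a z t))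
    (hP : Continuous fun w : Vec d × Vec d × ℝ => P w.1 w.2.1 w.2.2)
    {sGrad : Vec d → ℝ → Vec d → Vec d}
    (hsG : ∀ (t : ℝ), t ∈ Set.Icc 0 T → ∀ ψ ∈ Metric.sphere (0 : Vec d) 1, ∀ x : Vec d,
      HasGradientAt (fun a => suppF F a t ψ) (sGrad x t ψ) x)
    (hsGc : ContinuousOn (fun w : Vec d × ℝ × Vec d => sGrad w.1 w.2.1 w.2.2)
      (Set.univ ×ˢ Set.Icc 0 T ×ˢ Metric.sphere (0 : Vec d) 1)) {R : ℝ} (hR : 0 ≤ R) :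
    ∃ δ > 0, ∃ K > 0, ∀ z ∈ AsetDI T p x₀, (∀ t ∈ Icc 0 T, ‖z.1 t‖ ≤ R) →
      (phiDI T p F z.1 z.2).toReal < δ → ∀ s ∈ Icc (0 : ℝ) 1,
      ∃ w ∈ AsetDI T p x₀, (∀ t ∈ Icc 0 T, ‖w.1 t‖ ≤ R + 1) ∧
        (phiDI T p F w.1 w.2).toReal ≤ (1 - s) * (phiDI T p F z.1 z.2).toReal ∧
        distDI T p w z ≤ K * s * (phiDI T p F z.1 z.2).toReal := by
  obtain ⟨Q, l, hl, hQ, hmin, hLip, hQh⟩ := exists_truncated_residual_lipschitz (T := T) hFne hFcomp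
    hFconv hPF hP hsG hsGc (by positivity : 0 ≤ R + 1)
  obtain ⟨κ, hκ, hHol⟩ := exists_integral_norm_le_eLpNorm (d := d) T hp
  have hHol' : ∀ f : ℝ → Vec d, ∀ ρ : ℝ → ℝ, MemLp f (ENNReal.ofReal p) (muT T) →
      (∀ t ∈ Icc 0 T, ρ t = ‖f t‖) →
      ∫ t, ρ t ∂(muT T) ≤ κ * (eLpNorm ρ (ENNReal.ofReal p) (muT T)).toReal := by
    intro f ρ hf hρ
    rw [integral_congr_ae (ae_muT_of_forall hρ), eLpNorm_congr_ae (ae_muT_of_forall hρ),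
      eLpNorm_norm]
    exact hHol f hf
  set τ : ℝ := (eLpNorm (fun _ : ℝ => (1 : ℝ)) (ENNReal.ofReal p) (muT T)).toReal with hτdef
  have hτ : 0 ≤ τ := ENNReal.toReal_nonneg
  set C : ℝ := 2 * l * Real.exp (2 * l * T) with hCdef
  have hC : 0 < C := by positivity
  set D : ℝ := κ * (1 + C * T) with hDdef
  have hD : 0 ≤ D := by positivity
  refine ⟨1 / (D + 1), by positivity, D * τ + (1 + C * κ * τ), by positivity, ?_⟩
  intro z hz hzR hφ s hs
  have hzc := continuousOn_of_mem_AsetDI hT.le hp hz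
  obtain ⟨u, huLp, hu⟩ := exists_filippov_correction (P := Q) hT.le hQ hmin
    hl hLip hp hz.1.2.2 hz.1.2.1 hs
  set ρ : ℝ → ℝ := fun t => ‖z.2 t - Q (z.1 t) (z.2 t) t‖ with hρdef
  have hρLp : MemLp ρ (ENNReal.ofReal p) (muT T) := memLp_residual hQ hmin hzc hz.1.2.2
  have hρh : ∀ t ∈ Icc 0 T, ρ t = hfun F (z.1 t) (z.2 t) t := fun t ht =>
    hQh _ _ _ ((hzR t ht).trans (by linarith))
  have hφρ : (phiDI T p F z.1 z.2).toReal = (eLpNorm ρ (ENNReal.ofReal p) (muT T)).toReal := by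
    rw [phiDI, eLpNorm_congr_ae (ae_muT_of_forall hρh)]
  rw [hφρ] at hφ ⊢
  set φ : ℝ := (eLpNorm ρ (ENNReal.ofReal p) (muT T)).toReal with hφdef
  have hφ0 : 0 ≤ φ := ENNReal.toReal_nonneg
  have hρint : ∫ t, ρ t ∂(muT T) ≤ κ * φ :=
    hHol' (fun t => z.2 t - Q (z.1 t) (z.2 t) t) ρ
      ((memLp_norm_iff (hz.1.2.2.1.sub
        (aestronglyMeasurable_comp_muT hQ hzc hz.1.2.2.1))).1 hρLp) fun _ _ => rfl
  set M : ℝ := s * ∫ t, ρ t ∂(muT T) with hMdef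
  have hMφ : M ≤ s * (κ * φ) := mul_le_mul_of_nonneg_left hρint hs.1
  have hM0 : 0 ≤ M := mul_nonneg hs.1 (integral_nonneg fun _ => norm_nonneg _)
  set w : TrajDI d := (fun t => z.1 0 + ∫ τ in (0 : ℝ)..t, u τ, u) with hwdef
  have hwA : w ∈ AsetDI T p x₀ := by
    refine ⟨⟨intervalIntegrable_of_memLp_muT hp huLp ⟨hT.le, le_rfl⟩, fun t _ => ?_, huLp⟩, ?_⟩
    · simp [hwdef]
    · simp [hwdef, hz.2]
  have hρI : IntegrableOn ρ (Ioc 0 T) volume := (hρLp.mono_exponent hp).integrable le_rfl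
  have hwz : ∀ t ∈ Icc 0 T, ‖w.1 t - z.1 t‖ ≤ D * s * φ := by
    intro t ht
    have hsub : Ioc 0 t ⊆ Ioc 0 T := Ioc_subset_Ioc_right ht.2
    have hi : IntervalIntegrable ρ volume 0 t := by
      rw [intervalIntegrable_iff_integrableOn_Ioc_of_le ht.1]
      exact hρI.mono_set hsub
    have h1 : ∫ τ in Ioc 0 t, ρ τ ≤ ∫ τ, ρ τ ∂(muT T) :=
      setIntegral_mono_set hρI (ae_of_all _ fun _ => norm_nonneg _) hsub.eventuallyLE
    have h2 := norm_primitive_sub_le hp huLp hz.1.2.2 ht (g := fun τ => s * ρ τ + C * M)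
      ((hi.const_mul s).add (by simp)) (fun τ hτ => (hu τ hτ).2) (z.1 0)
    rw [← hz.1.2.1 t ht, intervalIntegral.integral_add (hi.const_mul s) (by simp),
      intervalIntegral.integral_const_mul, intervalIntegral.integral_of_le (f := ρ) ht.1,
      intervalIntegral.integral_const, smul_eq_mul, sub_zero] at h2
    have h3 : s * ∫ τ in Ioc 0 t, ρ τ ≤ M := mul_le_mul_of_nonneg_left h1 hs.1
    have h4 : t * (C * M) ≤ T * (C * M) := mul_le_mul_of_nonneg_right ht.2 (by positivity)
    calc ‖w.1 t - z.1 t‖ ≤ M * (1 + C * T) := by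
          refine h2.trans ?_
          linarith
      _ ≤ s * (κ * φ) * (1 + C * T) := mul_le_mul_of_nonneg_right hMφ (by positivity)
      _ = D * s * φ := by rw [hDdef]; ring
  have hwR : ∀ t ∈ Icc 0 T, ‖w.1 t‖ ≤ R + 1 := by
    intro t ht
    have h1 : φ * (D + 1) < 1 := (lt_div_iff₀ (by positivity)).1 hφ
    have h2 : D * s * φ ≤ D * φ := by
      have := mul_le_mul_of_nonneg_left hs.2 (mul_nonneg hD hφ0)
      linarith
    have h3 := norm_le_norm_add_norm_sub (z.1 t) (w.1 t)
    have h4 := norm_sub_rev (z.1 t) (w.1 t)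
    have h5 := hwz t ht
    have h6 := hzR t ht
    linarith
  refine ⟨w, hwA, hwR, ?_, ?_⟩
  · have := toReal_eLpNorm_le_of_norm_le hp hρLp (f := fun t => hfun F (w.1 t) (w.2 t) t)
      (sub_nonneg.2 hs.2) le_rfl (fun t ht => ?_)
    · simpa [phiDI, hφdef] using this
    · rw [← hQh _ _ _ (hwR t ht), norm_norm, add_zero]
      exact (hu t ht).1
  · have h1 := toReal_eLpNorm_le_of_norm_le hp hρLp (f := fun t => w.1 t - z.1 t) (a := 0)
      (b := D * s * φ) le_rfl (mul_nonneg (mul_nonneg hD hs.1) hφ0) (fun t ht => by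
        simpa using hwz t ht)
    have h2 := toReal_eLpNorm_le_of_norm_le hp hρLp (f := fun t => w.2 t - z.2 t) (a := s)
      (b := C * M) hs.1 (by positivity) (fun t ht => (hu t ht).2)
    have h3 : C * M * τ ≤ C * (s * (κ * φ)) * τ :=
      mul_le_mul_of_nonneg_right (mul_le_mul_of_nonneg_left hMφ hC.le) hτ
    rw [← hτdef] at h1 h2
    unfold distDI
    linarith

end Penalty

/-- Theorem 4.2: under assumptions (1)–(4), there exists `λ* ≥ 0` such that for all `λ ≥ λ*` the
penalty function `Φ_λ` for the free-endpoint problem involving a differential inclusion is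
completely exact on `S_λ(c)`. -/
theorem diff_inclusion_penalty_completely_exact {d : ℕ} (T : ℝ) (hT : 0 < T) (x₀ : Vec d)
    (p : ℝ) (hp : 1 < p)
    (θ : Vec d → ℝ → ℝ) (ζ : Vec d → ℝ)
    (F : Vec d → ℝ → Set (Vec d))
    -- assumption 1: smoothness of the objective function
    (hζ : LocallyLipschitz ζ)
    (θx : Vec d → ℝ → Vec d)
    (hθc : ContinuousOn (fun w : Vec d × ℝ => θ w.1 w.2) (Set.univ ×ˢ Set.Icc 0 T))
    (hθx : ∀ t : ℝ, t ∈ Set.Icc 0 T → ∀ a : Vec d,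
      HasGradientAt (fun a' => θ a' t) (θx a t) a)
    (hθxc : ContinuousOn (fun w : Vec d × ℝ => θx w.1 w.2) (Set.univ ×ˢ Set.Icc 0 T))
    -- assumption 2: the multifunction and its support function
    (hFne : ∀ (x : Vec d) (t : ℝ), (F x t).Nonempty)
    (hFcomp : ∀ (x : Vec d) (t : ℝ), IsCompact (F x t))
    (hFconv : ∀ (x : Vec d) (t : ℝ), Convex ℝ (F x t))
    (hFcont : Continuous (fun w : Vec d × ℝ =>
      (⟨⟨F w.1 w.2, hFcomp w.1 w.2⟩, hFne w.1 w.2⟩ : TopologicalSpace.NonemptyCompacts (Vec d))))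
    (sGrad : Vec d → ℝ → Vec d → Vec d)
    (hsG : ∀ (t : ℝ), t ∈ Set.Icc 0 T → ∀ ψ ∈ Metric.sphere (0 : Vec d) 1, ∀ x : Vec d,
      HasGradientAt (fun a => suppF F a t ψ) (sGrad x t ψ) x)
    (hsGc : ContinuousOn (fun w : Vec d × ℝ × Vec d => sGrad w.1 w.2.1 w.2.2)
      (Set.univ ×ˢ Set.Icc 0 T ×ˢ Metric.sphere (0 : Vec d) 1))
    -- assumption 3: a globally optimal solution exists
    (zopt : TrajDI d) (hzopt : zopt ∈ OsetDI T p x₀ F)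
    (hzoptmin : ∀ w ∈ OsetDI T p x₀ F, IvalDI T θ ζ zopt ≤ IvalDI T θ ζ w)
    -- assumption 4: boundedness of `S_{λ₀}(c) ∩ Ω_δ` and boundedness below of `Φ_{λ₀}`
    (c lam₀ δ : ℝ) (hc : IvalDI T θ ζ zopt < c) (hlam₀ : 0 < lam₀) (hδ : 0 < δ)
    (hbdd : ∃ R : ℝ, ∀ z ∈ AsetDI T p x₀,
      PhiDI T p θ ζ F lam₀ z < ((c : ℝ) : EReal) →
      phiDI T p F z.1 z.2 < ENNReal.ofReal δ → normDI T p z ≤ R)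
    (hbelow : ∃ b : ℝ, ∀ z ∈ AsetDI T p x₀, ((b : ℝ) : EReal) ≤ PhiDI T p θ ζ F lam₀ z) :
    ∃ lamStar : ℝ, 0 ≤ lamStar ∧ ∀ lam : ℝ, lamStar ≤ lam →
      -- 1) the optimal values of the two problems coincide
      (⨅ z ∈ AsetDI T p x₀, PhiDI T p θ ζ F lam z) = ((IvalDI T θ ζ zopt : ℝ) : EReal) ∧
      -- 2) the globally optimal solutions coincide
      ({z ∈ AsetDI T p x₀ | ∀ w ∈ AsetDI T p x₀, PhiDI T p θ ζ F lam z ≤ PhiDI T p θ ζ F lam w}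
        = {z ∈ OsetDI T p x₀ F | ∀ w ∈ OsetDI T p x₀ F, IvalDI T θ ζ z ≤ IvalDI T θ ζ w}) ∧
      -- 3) local minimisers in `S_λ(c)` coincide
      (∀ z ∈ AsetDI T p x₀, PhiDI T p θ ζ F lam z < ((c : ℝ) : EReal) →
        ((∃ ε : ℝ, 0 < ε ∧ ∀ w ∈ AsetDI T p x₀, distDI T p w z < ε →
            PhiDI T p θ ζ F lam z ≤ PhiDI T p θ ζ F lam w) ↔
          (z ∈ OsetDI T p x₀ F ∧ ∃ ε : ℝ, 0 < ε ∧ ∀ w ∈ OsetDI T p x₀ F,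
            distDI T p w z < ε → IvalDI T θ ζ z ≤ IvalDI T θ ζ w))) ∧
      -- 4) inf-stationary points in `S_λ(c)` coincide
      (∀ z ∈ AsetDI T p x₀, PhiDI T p θ ζ F lam z < ((c : ℝ) : EReal) →
        ((0 : EReal) ≤ rateDescentWith (distDI T p) (PhiDI T p θ ζ F lam) (AsetDI T p x₀) z ↔
          (z ∈ OsetDI T p x₀ F ∧ (0 : EReal) ≤ rateDescentWith (distDI T p)
            (fun w => ((IvalDI T θ ζ w : ℝ) : EReal)) (OsetDI T p x₀ F) z))) := by
  have hp1 : 1 ≤ ENNReal.ofReal p := by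
    rw [← ENNReal.ofReal_one]
    exact ENNReal.ofReal_le_ofReal hp.le
  choose P hPF using fun a z t => exists_isProjOn (hFne a t) (hFcomp a t) (hFconv a t) z
  have hP : Continuous fun w : Vec d × Vec d × ℝ => P w.1 w.2.1 w.2.2 :=
    (continuous_of_isProjOn (P := fun w z => P w.1 z w.2) hFcont
      (fun w z => hPF w.1 z w.2)).comp
      (f := fun w : Vec d × Vec d × ℝ => ((w.1, w.2.2), w.2.1)) (by fun_prop)
  have hfin : ∀ z ∈ AsetDI T p x₀, phiDI T p F z.1 z.2 ≠ ⊤ := fun z hz =>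
    (memLp_hfun hT.le hp1 hFcomp hPF hP hz).eLpNorm_ne_top
  obtain ⟨R₀, hR₀⟩ := hbdd
  obtain ⟨b, hb⟩ := hbelow
  obtain ⟨κ, hκ, hHol⟩ := exists_integral_norm_le_eLpNorm (d := d) T hp1
  set R : ℝ := ‖x₀‖ + κ * |R₀| with hRdef
  have hR : 0 ≤ R := by positivity
  obtain ⟨δ₁, hδ₁, K, hK, hdec⟩ := exists_penalty_decrease (x₀ := x₀) hT hp1 hFne hFcomp hFconv
    hPF hP hsG hsGc hR
  obtain ⟨L, hL, hLip⟩ := exists_lipschitz_IvalDI hT.le hζ hθc hθx hθxc (R + 1)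
  set δ₂ : ℝ := min δ δ₁ with hδ₂def
  have hδ₂ : 0 < δ₂ := lt_min hδ hδ₁
  refine ⟨lam₀ + |c - b| / δ₂ + L * κ * K + 1, by positivity, fun lam hlam => ?_⟩
  have hq : 0 ≤ |c - b| / δ₂ := by positivity
  have hLK : 0 ≤ L * κ * K := by positivity
  have hsmall : ∀ z ∈ AsetDI T p x₀,
      IvalDI T θ ζ z + lam * (phiDI T p F z.1 z.2).toReal < c →
      (phiDI T p F z.1 z.2).toReal < δ₂ ∧ ∀ t ∈ Icc 0 T, ‖z.1 t‖ ≤ R := by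
    intro z hz hzc
    have hbz := hb z hz
    have hRz := hR₀ z hz
    rw [PhiDI_eq_coe (hfin z hz), EReal.coe_le_coe_iff] at hbz
    rw [PhiDI_eq_coe (hfin z hz), EReal.coe_lt_coe_iff] at hRz
    set φ : ℝ := (phiDI T p F z.1 z.2).toReal with hφdef
    have hφ0 : 0 ≤ φ := ENNReal.toReal_nonneg
    have hlt : φ < δ₂ := by
      by_contra! hcon
      have h1 : |c - b| / δ₂ * δ₂ = |c - b| := div_mul_cancel₀ _ hδ₂.ne'
      have h2 : |c - b| / δ₂ * δ₂ ≤ (lam - lam₀) * φ :=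
        mul_le_mul (by linarith) hcon hδ₂.le (by linarith)
      have h3 := le_abs_self (c - b)
      linarith
    refine ⟨hlt, fun t ht => ?_⟩
    have h1 : lam₀ * φ ≤ lam * φ := mul_le_mul_of_nonneg_right (by linarith) hφ0
    have h2 := hRz (by linarith) (by
      rw [← ENNReal.ofReal_toReal (hfin z hz)]
      exact (ENNReal.ofReal_lt_ofReal_iff hδ).2 (hlt.trans_le (min_le_left _ _)))
    refine (norm_le_of_mem_AsetDI hp1 hκ hHol hz ht).trans ?_
    have := mul_le_mul_of_nonneg_left (h2.trans (le_abs_self R₀)) hκ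
    linarith
  refine completely_exact_of_proportional_decrease
    (U := {z | z ∈ AsetDI T p x₀ ∧ ∀ t ∈ Icc 0 T, ‖z.1 t‖ ≤ R + 1})
    (φ := fun z => (phiDI T p F z.1 z.2).toReal) (I := IvalDI T θ ζ) (K := K) (L := L * κ)
    (lam := lam) (fun z => mem_OsetDI_iff hT.le hp1 hFcomp hPF hP)
    (fun _ _ => ENNReal.toReal_nonneg) distDI_nonneg
    (fun x hx y hy z hz => distDI_triangle hT.le hp1 hx hy hz)
    (fun z hz w hw h => congrArg _ (phiDI_eq_of_distDI_eq_zero hT.le hp1 F hz hw h))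
    (fun z hz => PhiDI_eq_coe (hfin z hz) lam) hzopt hzoptmin hc hK (mul_nonneg hL hκ)
    (by linarith) ?_ ?_ ?_
  · rintro z ⟨hz, hzR⟩ w ⟨hw, hwR⟩
    rw [mul_assoc]
    exact hLip z w (continuousOn_of_mem_AsetDI hT.le hp1 hz)
      (continuousOn_of_mem_AsetDI hT.le hp1 hw) hzR hwR _
      fun t ht => norm_sub_le_distDI hp1 hκ hHol hz hw ht
  · intro z hz hzc
    exact ⟨hz, fun t ht => ((hsmall z hz hzc).2 t ht).trans (by linarith)⟩
  · intro z hz hzc s hs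
    obtain ⟨h1, h2⟩ := hsmall z hz hzc
    obtain ⟨w, hw, hwR, h3, h4⟩ := hdec z hz h2 (h1.trans_le (min_le_right _ _)) s hs
    exact ⟨w, hw, ⟨hw, hwR⟩, h3, h4⟩
end
end

section
/- Let θ : ℝ^d×ℝ^m×[0,T] → ℝ be continuous and 1 ≤ q < +∞. Then the integral ∫₀^T θ(x(t),u(t),t) dt is correctly defined and finite for every x ∈ L^∞_d(0,T) and every u ∈ L^q_m(0,T) if and only if for every R > 0 there exist C_R > 0 and an a.e. nonnegative function ω_R ∈ L^1(0,T) such that |θ(x,u,t)| ≤ C_R|u|^q + ω_R(t) for a.e. t ∈ [0,T] and all (x,u) ∈ ℝ^d×ℝ^m with |x| ≤ R. -/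
open MeasureTheory Set Filter Topology
open scoped ENNReal NNReal

noncomputable section

/-- A set carrying mass more than `A` has a subset carrying mass exactly `A`, for measures with a
finite density. -/
theorem exists_subset_setLIntegral_eq {T : ℝ} (hT : 0 ≤ T) {f : ℝ → ℝ≥0} (hf : Measurable f)
    {E : Set ℝ} (hE : MeasurableSet E) {A : ℝ≥0}
    (hA : (A : ℝ≥0∞) < ∫⁻ t in E, f t ∂(muT T)) :
    ∃ E' ⊆ E, MeasurableSet E' ∧ ∫⁻ t in E', f t ∂(muT T) = A := by
  have hfin : IsFiniteMeasure (muT T) := by unfold muT; infer_instance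
  set S : ℕ → Set ℝ := fun j => E ∩ {t | f t ≤ j} with hS
  have hSm : ∀ j, MeasurableSet (S j) := fun j => hE.inter (hf measurableSet_Iic)
  have hSU : E = ⋃ j, S j := by
    ext t
    simp only [hS, mem_iUnion, mem_inter_iff, exists_and_left, mem_ofPred_eq]
    exact ⟨fun h => ⟨h, exists_nat_ge _⟩, fun h => h.1⟩
  have hmono : Monotone S := fun i j hij t ht => ⟨ht.1, le_trans (b := (i : ℝ≥0)) ht.2 (by exact_mod_cast hij)⟩
  obtain ⟨j, hj⟩ : ∃ j, (A : ℝ≥0∞) < ∫⁻ t in S j, f t ∂(muT T) := by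
    rw [hSU, setLIntegral_iUnion_of_directed _ hmono.directed_le] at hA
    exact lt_iSup_iff.1 hA
  set g : ℝ → ℝ := (S j).indicator (fun t => (f t : ℝ)) with hg
  have hgm : Measurable g := (measurable_coe_nnreal_real.comp hf).indicator (hSm j)
  have hg0 : ∀ t, 0 ≤ g t := fun t => indicator_nonneg (fun _ _ => NNReal.coe_nonneg _) _
  have hgb : ∀ t, ‖g t‖ ≤ j := by
    intro t
    rw [Real.norm_of_nonneg (hg0 t)]
    by_cases ht : t ∈ S j
    · simpa [hg, ht] using (by exact_mod_cast ht.2 : (f t : ℝ) ≤ j)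
    · simp [hg, ht]
  have hint : ∀ a b, IntervalIntegrable g volume a b := by
    intro a b
    rw [intervalIntegrable_iff]
    exact Measure.integrableOn_of_bounded (by simp) hgm.aestronglyMeasurable
      (ae_of_all _ hgb)
  have key : ∀ s ∈ Icc 0 T, ENNReal.ofReal (∫ t in (0 : ℝ)..s, g t)
      = ∫⁻ t in S j ∩ Iic s, f t ∂(muT T) := by
    intro s hs
    rw [intervalIntegral.integral_of_le hs.1,
      ofReal_integral_eq_lintegral_ofReal ((intervalIntegrable_iff_integrableOn_Ioc_of_le hs.1).1
        (hint 0 s)) (ae_of_all _ hg0)]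
    have : (fun t => ENNReal.ofReal (g t)) = (S j).indicator (fun t => (f t : ℝ≥0∞)) := by
      ext t
      by_cases ht : t ∈ S j <;> simp [hg, ht]
    rw [this, setLIntegral_indicator (hSm j), muT, Measure.restrict_restrict
      ((hSm j).inter measurableSet_Iic)]
    congr 2
    ext t
    simp only [mem_inter_iff, mem_Ioc, mem_Iic]
    constructor
    · rintro ⟨h1, h2, h3⟩; exact ⟨⟨h1, h3⟩, h2, h3.trans hs.2⟩
    · rintro ⟨⟨h1, h3⟩, h2, _⟩; exact ⟨h1, h2, h3⟩
  have hST : ∫⁻ t in S j ∩ Iic T, f t ∂(muT T) = ∫⁻ t in S j, f t ∂(muT T) := by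
    rw [muT, Measure.restrict_restrict ((hSm j).inter measurableSet_Iic),
      Measure.restrict_restrict (hSm j)]
    congr 2
    ext t
    simp only [mem_inter_iff, mem_Ioc, mem_Iic]
    tauto
  have hcont : ContinuousOn (fun s => ∫ t in (0 : ℝ)..s, g t) (Icc 0 T) :=
    (intervalIntegral.continuous_primitive hint 0).continuousOn
  obtain ⟨s, hs, hsA⟩ := intermediate_value_Icc hT hcont (show (A : ℝ) ∈ _ by
    refine ⟨by simp, ?_⟩
    have := key T ⟨hT, le_rfl⟩
    rw [hST] at this
    rw [← this] at hj
    by_contra! h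
    have h2 := ENNReal.ofReal_le_ofReal h.le
    rw [ENNReal.ofReal_coe_nnreal] at h2
    exact absurd hj h2.not_gt)
  refine ⟨S j ∩ Iic s, fun t ht => ht.1.1, (hSm j).inter measurableSet_Iic, ?_⟩
  rw [← key s hs]
  simp only at hsA
  rw [hsA, ENNReal.ofReal_coe_nnreal]

/-- If the supremum of countably many functions `α i - c * β i` has infinite integral, then some
measurable selection has large integral on a set where the selected function is nonnegative. -/
theorem exists_selection_lt_setLIntegral {Ω : Type*} [MeasurableSpace Ω] {μ : Measure Ω}
    {α : ℕ → Ω → ℝ≥0} (hα : ∀ i, Measurable (α i)) (β : ℕ → ℝ≥0) (c A : ℝ≥0)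
    (h : ∫⁻ t, ⨆ i, ((α i t - c * β i : ℝ≥0) : ℝ≥0∞) ∂μ = ∞) :
    ∃ n : Ω → ℕ, Measurable n ∧ ∃ E, MeasurableSet E ∧ (∀ t ∈ E, c * β (n t) ≤ α (n t) t) ∧
      (A : ℝ≥0∞) < ∫⁻ t in E, α (n t) t ∂μ := by
  classical
  rw [lintegral_eq_nnreal] at h
  have h2 : ((2 * A : ℝ≥0) : ℝ≥0∞) < ∞ := ENNReal.coe_lt_top
  rw [← h] at h2
  simp only [lt_iSup_iff] at h2
  obtain ⟨φ, hφ, hA⟩ := h2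
  have hp : ∀ t, ∃ i, φ t = 0 ∨ φ t / 2 < α i t - c * β i := by
    intro t
    by_cases h0 : φ t = 0
    · exact ⟨0, Or.inl h0⟩
    · have : ((φ t / 2 : ℝ≥0) : ℝ≥0∞) < ⨆ i, ((α i t - c * β i : ℝ≥0) : ℝ≥0∞) :=
        lt_of_lt_of_le (by exact_mod_cast NNReal.half_lt_self h0) (hφ t)
      obtain ⟨i, hi⟩ := lt_iSup_iff.1 this
      exact ⟨i, Or.inr (by exact_mod_cast hi)⟩
  have hEm : MeasurableSet {t | φ t ≠ 0} := (φ.measurable (measurableSet_singleton 0)).compl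
  have hsel : ∀ t, φ t ≠ 0 → φ t / 2 < α (Nat.find (hp t)) t - c * β (Nat.find (hp t)) :=
    fun t ht => (Nat.find_spec (hp t)).resolve_left ht
  refine ⟨fun t => Nat.find (hp t), measurable_find hp fun k => ?_, {t | φ t ≠ 0}, hEm, ?_, ?_⟩
  · have hlt : MeasurableSet {t | φ t / 2 < α k t - c * β k} :=
      measurableSet_lt (φ.measurable.div_const 2) ((hα k).sub_const _)
    exact (φ.measurable (measurableSet_singleton 0)).union hlt
  · intro t ht
    exact (tsub_pos_iff_lt.1 (zero_le.trans_lt (hsel t ht))).le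
  · have h3 : (φ.map ((↑) : ℝ≥0 → ℝ≥0∞)).lintegral μ = 2 * ∫⁻ t, ((φ t / 2 : ℝ≥0) : ℝ≥0∞) ∂μ := by
      rw [← SimpleFunc.lintegral_eq_lintegral, ← lintegral_const_mul]
      · refine lintegral_congr fun t => ?_
        simp only [SimpleFunc.map_apply]
        norm_cast
        rw [mul_div_cancel₀ _ two_ne_zero]
      · exact (φ.measurable.div_const 2).coe_nnreal_ennreal
    rw [h3] at hA
    rw [ENNReal.coe_mul, ENNReal.coe_ofNat] at hA
    have h4 : (A : ℝ≥0∞) < ∫⁻ t, ((φ t / 2 : ℝ≥0) : ℝ≥0∞) ∂μ := by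
      by_contra! h
      have := mul_le_mul_right h (2 : ℝ≥0∞)
      exact absurd hA this.not_gt
    refine h4.trans_le ?_
    rw [← lintegral_indicator hEm]
    refine lintegral_mono fun t => ?_
    by_cases ht : φ t = 0
    · simp [ht]
    · rw [indicator_of_mem (show t ∈ {t | φ t ≠ 0} from ht)]
      exact ENNReal.coe_le_coe.2 ((hsel t ht).le.trans tsub_le_self)

/-- Countably many partial selections with summable costs `β ≥ 1` can be merged into one measurable
selection of finite cost whose value dominates that of each of them. -/
theorem exists_selection_dominating {Ω : Type*} [MeasurableSpace Ω] {μ : Measure Ω}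
    [IsFiniteMeasure μ] {α : ℕ → Ω → ℝ≥0} (hα : ∀ i, Measurable (α i)) {β : ℕ → ℝ≥0}
    (hβ : ∀ i, 1 ≤ β i) {n : ℕ → Ω → ℕ} (hn : ∀ k, Measurable (n k)) {E : ℕ → Set Ω}
    (hE : ∀ k, MeasurableSet (E k)) (hsum : ∑' k, ∫⁻ t in E k, β (n k t) ∂μ ≠ ∞) :
    ∃ N : Ω → ℕ, Measurable N ∧ ∫⁻ t, β (N t) ∂μ ≠ ∞ ∧
      ∀ k, ∫⁻ t in E k, α (n k t) t ∂μ ≤ ∫⁻ t, α (N t) t ∂μ := by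
  classical
  have hαn : ∀ m : Ω → ℕ, Measurable m → Measurable fun t => α (m t) t := fun m hm =>
    (measurable_from_prod_countable_right (f := fun p : ℕ × Ω => α p.1 p.2) hα).comp
      (hm.prodMk measurable_id)
  set F : ℕ → Ω → ℝ≥0 := fun k => (E k).indicator fun t => α (n k t) t with hF
  have hFm : ∀ k, Measurable (F k) := fun k => (hαn _ (hn k)).indicator (hE k)
  set B : ℕ → Ω → ℝ≥0∞ := fun k => (E k).indicator fun t => (β (n k t) : ℝ≥0∞) with hB
  have hBm : ∀ k, Measurable (B k) := fun k =>
    (measurable_from_nat.comp (g := fun i => (β i : ℝ≥0∞)) (hn k)).indicator (hE k)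
  have hBsum : ∫⁻ t, ∑' k, B k t ∂μ ≠ ∞ := by
    rw [lintegral_tsum fun k => (hBm k).aemeasurable]
    simpa only [hB, lintegral_indicator (hE _)] using hsum
  have hpm : ∀ k, MeasurableSet {t | ∀ j, F j t ≤ F k t} := fun k => by
    rw [ofPred_forall]
    exact MeasurableSet.iInter fun j => measurableSet_le (hFm j) (hFm k)
  have hP : ∀ t, ∃ k, (∀ j, F j t ≤ F k t) ∨ ¬ ∃ k, ∀ j, F j t ≤ F k t := by
    intro t
    by_cases h : ∃ k, ∀ j, F j t ≤ F k t
    · exact ⟨h.choose, Or.inl h.choose_spec⟩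
    · exact ⟨0, Or.inr h⟩
  have hM : Measurable fun t => Nat.find (hP t) := by
    refine measurable_find hP fun k => (hpm k).union ?_
    have : {t | ∃ k, ∀ j, F j t ≤ F k t} = ⋃ k, {t | ∀ j, F j t ≤ F k t} := by
      ext t; simp
    exact (this ▸ MeasurableSet.iUnion hpm : MeasurableSet {t | ∃ k, ∀ j, F j t ≤ F k t}).compl
  set M : Ω → ℕ := fun t => Nat.find (hP t) with hMdef
  have hME : MeasurableSet {t | t ∈ E (M t)} := by
    have : {t | t ∈ E (M t)} = ⋃ k, M ⁻¹' {k} ∩ E k := by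
      ext t; simp
    rw [this]
    exact MeasurableSet.iUnion fun k => (hM (measurableSet_singleton k)).inter (hE k)
  have hnM : Measurable fun t => n (M t) t :=
    (measurable_from_prod_countable_right (f := fun p : ℕ × Ω => n p.1 p.2) hn).comp
      (hM.prodMk measurable_id)
  refine ⟨fun t => if t ∈ E (M t) then n (M t) t else 0, hnM.ite hME measurable_const, ?_, ?_⟩
  · have hle : ∀ t, ((β (if t ∈ E (M t) then n (M t) t else 0) : ℝ≥0) : ℝ≥0∞)
        ≤ β 0 + ∑' k, B k t := by
      intro t
      split_ifs with h
      · refine le_trans ?_ le_add_self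
        refine le_trans ?_ (ENNReal.le_tsum (M t))
        simp [hB, h]
      · exact le_self_add
    refine ((lintegral_mono hle).trans_lt ?_).ne
    rw [lintegral_add_left measurable_const, lintegral_const]
    exact ENNReal.add_lt_top.2 ⟨ENNReal.mul_lt_top ENNReal.coe_lt_top (measure_lt_top _ _),
      hBsum.lt_top⟩
  · intro k
    rw [← lintegral_indicator (hE k)]
    refine lintegral_mono_ae ?_
    filter_upwards [ae_lt_top (Measurable.tsum hBm) hBsum] with t ht
    have hfin : {j | t ∈ E j}.Finite := by
      refine (ENNReal.finite_const_le_of_tsum_ne_top ht.ne one_ne_zero).subset fun j hj => ?_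
      have : t ∈ E j := hj
      simpa [hB, this] using hβ _
    obtain ⟨m, -, hm⟩ := Set.exists_max_image (insert 0 {j | t ∈ E j}) (fun j => F j t)
      (hfin.insert 0) ⟨0, mem_insert _ _⟩
    have hex : ∃ k, ∀ j, F j t ≤ F k t := by
      refine ⟨m, fun j => ?_⟩
      by_cases hj : t ∈ E j
      · exact hm j (mem_insert_of_mem _ hj)
      · simp [hF, hj]
    have hmax : F k t ≤ F (M t) t :=
      (Nat.find_spec (hP t)).resolve_right (not_not_intro hex) k
    have hFk : (E k).indicator (fun t => (α (n k t) t : ℝ≥0∞)) t = F k t := by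
      by_cases hk : t ∈ E k <;> simp [hF, hk]
    rw [hFk]
    refine ENNReal.coe_le_coe.2 (hmax.trans ?_)
    by_cases h : t ∈ E (M t) <;> simp [hF, h]

/-- If every measurable selection with finite cost `β` has finite value `α`, then for some
multiplier `c` the penalised supremum `⨆ i, (α i - c * β i)` has finite integral. -/
theorem exists_lintegral_iSup_sub_ne_top {T : ℝ} (hT : 0 ≤ T) {α : ℕ → ℝ → ℝ≥0}
    (hα : ∀ i, Measurable (α i)) {β : ℕ → ℝ≥0} (hβ : ∀ i, 1 ≤ β i)
    (h : ∀ N : ℝ → ℕ, Measurable N → ∫⁻ t, β (N t) ∂(muT T) ≠ ∞ →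
      ∫⁻ t, α (N t) t ∂(muT T) ≠ ∞) :
    ∃ c : ℝ≥0, 0 < c ∧ ∫⁻ t, ⨆ i, ((α i t - c * β i : ℝ≥0) : ℝ≥0∞) ∂(muT T) ≠ ∞ := by
  have hfin : IsFiniteMeasure (muT T) := by unfold muT; infer_instance
  by_contra! hc
  have hstep : ∀ k : ℕ, ∃ n : ℝ → ℕ, Measurable n ∧ ∃ E, MeasurableSet E ∧
      ∫⁻ t in E, α (n t) t ∂(muT T) = (k : ℝ≥0) ∧
      ∫⁻ t in E, β (n t) ∂(muT T) ≤ 2⁻¹ ^ k := by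
    intro k
    set c : ℝ≥0 := (k + 1) * 2 ^ k with hcdef
    have hcpos : 0 < c := by positivity
    obtain ⟨n, hn, E, hE, hβα, hlt⟩ := exists_selection_lt_setLIntegral hα β c k (hc c hcpos)
    obtain ⟨E', hE'E, hE', hval⟩ := exists_subset_setLIntegral_eq hT
      ((measurable_from_prod_countable_right (f := fun p : ℕ × ℝ => α p.1 p.2) hα).comp
        (hn.prodMk measurable_id)) hE hlt
    refine ⟨n, hn, E', hE', hval, ?_⟩
    have h1 : (c : ℝ≥0∞) * ∫⁻ t in E', β (n t) ∂(muT T) ≤ (k : ℝ≥0) := by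
      have hβn : Measurable fun t => (β (n t) : ℝ≥0∞) :=
        measurable_from_nat.comp (g := fun i => (β i : ℝ≥0∞)) hn
      rw [← lintegral_const_mul _ hβn, ← hval]
      refine setLIntegral_mono' hE' fun t ht => ?_
      exact_mod_cast hβα t (hE'E ht)
    have h2 : ((k : ℝ≥0) : ℝ≥0∞) ≤ c * 2⁻¹ ^ k := by
      have : (k : ℝ≥0) ≤ c * 2⁻¹ ^ k := by
        rw [hcdef, mul_assoc, ← mul_pow, mul_inv_cancel₀ two_ne_zero, one_pow, mul_one]
        exact le_self_add
      have h3 := ENNReal.coe_le_coe.2 this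
      rwa [ENNReal.coe_mul, ENNReal.coe_pow, ENNReal.coe_inv two_ne_zero, ENNReal.coe_ofNat] at h3
    exact (ENNReal.mul_le_mul_iff_right (by exact_mod_cast hcpos.ne') ENNReal.coe_ne_top).1
      (h1.trans h2)
  choose n hn E hE hval hcost using hstep
  have hsum : ∑' k, ∫⁻ t in E k, β (n k t) ∂(muT T) ≠ ∞ := by
    refine ((ENNReal.tsum_le_tsum hcost).trans_lt ?_).ne
    rw [ENNReal.tsum_geometric, ENNReal.one_sub_inv_two, inv_inv]
    exact ENNReal.ofNat_lt_top
  obtain ⟨N, hN, hNβ, hNα⟩ := exists_selection_dominating hα hβ hn hE hsum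
  refine h N hN hNβ (ENNReal.eq_top_of_forall_nnreal_le fun r => ?_)
  obtain ⟨k, hk⟩ := exists_nat_ge r
  exact (ENNReal.coe_le_coe.2 hk).trans ((hval k).symm.le.trans (hNα k))

/-- The growth condition of order `(q, 1)` implies integrability along `L^∞ × L^q` pairs. -/
theorem integrable_comp_of_growth {d m : ℕ} {T q : ℝ} (hq : 1 ≤ q)
    {θ : Vec d → Vec m → ℝ → ℝ}
    (hθ : Continuous fun z : Vec d × Vec m × ℝ => θ z.1 z.2.1 z.2.2)
    (h : ∀ R : ℝ, 0 < R → ∃ C : ℝ, 0 < C ∧ ∃ ω : ℝ → ℝ,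
      Integrable ω (muT T) ∧ (∀ᵐ t ∂(muT T), 0 ≤ ω t) ∧
      ∀ᵐ t ∂(muT T), ∀ (a : Vec d) (b : Vec m), ‖a‖ ≤ R → |θ a b t| ≤ C * ‖b‖ ^ q + ω t)
    {x : ℝ → Vec d} {u : ℝ → Vec m} (hx : MemLp x ⊤ (muT T))
    (hu : MemLp u (ENNReal.ofReal q) (muT T)) :
    Integrable (fun t => θ (x t) (u t) t) (muT T) := by
  obtain ⟨R, hxR⟩ : ∃ R : ℝ, ∀ᵐ t ∂(muT T), ‖x t‖ ≤ R := by
    have hlt : eLpNormEssSup x (muT T) < ∞ := by simpa using hx.2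
    refine ⟨(eLpNormEssSup x (muT T)).toReal, ?_⟩
    filter_upwards [ae_le_eLpNormEssSup (f := x) (μ := muT T)] with t ht
    simpa using ENNReal.toReal_mono hlt.ne ht
  obtain ⟨C, -, ω, hω, -, hle⟩ := h (max R 1) (by positivity)
  have hq0 : ENNReal.ofReal q ≠ 0 := by simp; linarith
  have huq := hu.integrable_norm_rpow hq0 ENNReal.ofReal_ne_top
  rw [ENNReal.toReal_ofReal (by linarith)] at huq
  refine ((huq.const_mul C).add hω).mono'
    (hθ.comp_aestronglyMeasurable (hx.1.prodMk (hu.1.prodMk aestronglyMeasurable_id))) ?_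
  filter_upwards [hxR, hle] with t h1 h2
  exact h2 _ _ (h1.trans (le_max_left _ _))

/-- Integrability along all `L^∞ × L^q` pairs forces the growth condition of order `(q, 1)`. -/
theorem growth_of_integrable_comp {d m : ℕ} {T q : ℝ} (hT : 0 < T) (hq : 1 ≤ q)
    {θ : Vec d → Vec m → ℝ → ℝ}
    (hθ : Continuous fun z : Vec d × Vec m × ℝ => θ z.1 z.2.1 z.2.2)
    (h : ∀ (x : ℝ → Vec d) (u : ℝ → Vec m), MemLp x ⊤ (muT T) →
        MemLp u (ENNReal.ofReal q) (muT T) → Integrable (fun t => θ (x t) (u t) t) (muT T))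
    {R : ℝ} (hR : 0 < R) :
    ∃ C : ℝ, 0 < C ∧ ∃ ω : ℝ → ℝ, Integrable ω (muT T) ∧ (∀ᵐ t ∂(muT T), 0 ≤ ω t) ∧
      ∀ᵐ t ∂(muT T), ∀ (a : Vec d) (b : Vec m), ‖a‖ ≤ R → |θ a b t| ≤ C * ‖b‖ ^ q + ω t := by
  have hfin : IsFiniteMeasure (muT T) := by unfold muT; infer_instance
  have hq0 : 0 < q := by linarith
  have : Nonempty (Metric.closedBall (0 : Vec d) R × Vec m) :=
    ⟨⟨0, Metric.mem_closedBall_self hR.le⟩, 0⟩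
  set s := TopologicalSpace.denseSeq (Metric.closedBall (0 : Vec d) R × Vec m)
  set α : ℕ → ℝ → ℝ≥0 := fun i t => ‖θ (s i).1 (s i).2 t‖₊ with hαdef
  set β : ℕ → ℝ≥0 := fun i => 1 + ‖(s i).2‖₊ ^ q with hβdef
  have hα : ∀ i, Measurable (α i) := fun i =>
    (hθ.comp (continuous_const.prodMk (continuous_const.prodMk continuous_id))).nnnorm.measurable
  obtain ⟨c, hc, hsup⟩ := exists_lintegral_iSup_sub_ne_top hT.le hα (β := β)
    (fun i => le_self_add) (by
      intro N hN hNβ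
      have hxm : Measurable fun t => ((s (N t)).1 : Vec d) :=
        measurable_from_nat.comp (g := fun i => ((s i).1 : Vec d)) hN
      have hum : Measurable fun t => (s (N t)).2 :=
        measurable_from_nat.comp (g := fun i => (s i).2) hN
      refine (h (fun t => (s (N t)).1) (fun t => (s (N t)).2)
        (memLp_top_of_bound hxm.aestronglyMeasurable R (ae_of_all _ fun t => ?_))
        ⟨hum.aestronglyMeasurable, ?_⟩).2.ne
      · exact mem_closedBall_zero_iff.1 (s (N t)).1.2
      · rw [eLpNorm_lt_top_iff_lintegral_rpow_enorm_lt_top (by simpa using hq0)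
          ENNReal.ofReal_ne_top, ENNReal.toReal_ofReal hq0.le]
        refine (lintegral_mono fun t => ?_).trans_lt hNβ.lt_top
        rw [enorm_eq_nnnorm, ← ENNReal.coe_rpow_of_nonneg _ hq0.le]
        exact ENNReal.coe_le_coe.2 le_add_self)
  set G : ℝ → ℝ≥0∞ := fun t => ⨆ i, ((α i t - c * β i : ℝ≥0) : ℝ≥0∞) with hG
  have hGm : Measurable G :=
    Measurable.iSup fun i => ((hα i).sub_const _).coe_nnreal_ennreal
  refine ⟨c, hc, fun t => (G t).toReal + c,
    (integrable_toReal_of_lintegral_ne_top hGm.aemeasurable hsup).add (integrable_const _),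
    ae_of_all _ fun t => by positivity, ?_⟩
  filter_upwards [ae_lt_top hGm hsup] with t ht a b ha
  have hcont : Continuous fun z : Metric.closedBall (0 : Vec d) R × Vec m =>
      θ z.1 z.2 t := hθ.comp ((continuous_subtype_val.comp continuous_fst).prodMk
        (continuous_snd.prodMk continuous_const))
  refine (TopologicalSpace.denseRange_denseSeq
    (Metric.closedBall (0 : Vec d) R × Vec m)).induction_on
    (p := fun z => |θ z.1 z.2 t| ≤ c * ‖z.2‖ ^ q + ((G t).toReal + c))
    (⟨a, mem_closedBall_zero_iff.2 ha⟩, b) ?_ fun i => ?_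
  · exact isClosed_le hcont.abs (((continuous_snd.norm.rpow_const fun _ => Or.inr hq0.le).const_mul
      _).add continuous_const)
  · have h1 : ((α i t - c * β i : ℝ≥0) : ℝ≥0∞) ≤ G t :=
      le_iSup (fun i => ((α i t - c * β i : ℝ≥0) : ℝ≥0∞)) i
    have h2 : α i t - c * β i ≤ (G t).toNNReal := ENNReal.le_toNNReal_of_coe_le h1 ht.ne
    have h3 : α i t ≤ (G t).toNNReal + c * β i := tsub_le_iff_right.1 h2
    have h4 : |θ (s i).1 (s i).2 t| ≤ (G t).toReal + c * (1 + ‖(s i).2‖ ^ q) := by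
      have := NNReal.coe_le_coe.2 h3
      simpa [hαdef, hβdef, ENNReal.coe_toNNReal_eq_toReal] using this
    show |θ (s i).1 (s i).2 t| ≤ c * ‖(s i).2‖ ^ q + ((G t).toReal + c)
    linarith

/-- Proposition B.1: for continuous `θ` and `1 ≤ q < ∞`, the integral functional
`(x,u) ↦ ∫₀^T θ(x(t),u(t),t) dt` is correctly defined and finite for every `x ∈ L^∞_d(0,T)` and
`u ∈ L^q_m(0,T)` if and only if `θ` satisfies the growth condition of order `(q,1)`. -/
theorem integral_functional_defined_iff_growth {d m : ℕ} (T : ℝ) (hT : 0 < T)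
    (q : ℝ) (hq : 1 ≤ q)
    (θ : Vec d → Vec m → ℝ → ℝ)
    (hθc : ContinuousOn (fun z : Vec d × Vec m × ℝ => θ z.1 z.2.1 z.2.2)
      (Set.univ ×ˢ Set.univ ×ˢ Set.Icc 0 T)) :
    (∀ (x : ℝ → Vec d) (u : ℝ → Vec m), MemLp x ⊤ (muT T) →
        MemLp u (ENNReal.ofReal q) (muT T) →
        Integrable (fun t => θ (x t) (u t) t) (muT T)) ↔
    (∀ R : ℝ, 0 < R → ∃ C : ℝ, 0 < C ∧ ∃ ω : ℝ → ℝ,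
      Integrable ω (muT T) ∧ (∀ᵐ t ∂(muT T), 0 ≤ ω t) ∧
      ∀ᵐ t ∂(muT T), ∀ (a : Vec d) (b : Vec m), ‖a‖ ≤ R →
        |θ a b t| ≤ C * ‖b‖ ^ q + ω t) := by
  set Θ : Vec d → Vec m → ℝ → ℝ := fun a b t => θ a b (projIcc 0 T hT.le t) with hΘdef
  have hΘ : Continuous fun z : Vec d × Vec m × ℝ => Θ z.1 z.2.1 z.2.2 :=
    hθc.comp_continuous (f := fun z : Vec d × Vec m × ℝ =>
        (z.1, z.2.1, (projIcc 0 T hT.le z.2.2 : ℝ)))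
      (continuous_fst.prodMk (continuous_snd.fst.prodMk
        (continuous_subtype_val.comp (continuous_projIcc.comp continuous_snd.snd))))
      fun z => ⟨mem_univ _, mem_univ _, (projIcc 0 T hT.le z.2.2).2⟩
  have hae : ∀ᵐ t ∂(muT T), ∀ a b, Θ a b t = θ a b t := by
    filter_upwards [ae_restrict_mem measurableSet_Ioc] with t ht a b
    rw [hΘdef]
    simp only [projIcc_of_mem hT.le (Ioc_subset_Icc_self ht)]
  have hint : ∀ (x : ℝ → Vec d) (u : ℝ → Vec m),
      Integrable (fun t => θ (x t) (u t) t) (muT T) ↔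
        Integrable (fun t => Θ (x t) (u t) t) (muT T) := fun x u =>
    integrable_congr (hae.mono fun t ht => (ht _ _).symm)
  have hgrowth : ∀ (R C : ℝ) (ω : ℝ → ℝ),
      (∀ᵐ t ∂(muT T), ∀ a b, ‖a‖ ≤ R → |θ a b t| ≤ C * ‖b‖ ^ q + ω t) ↔
        ∀ᵐ t ∂(muT T), ∀ a b, ‖a‖ ≤ R → |Θ a b t| ≤ C * ‖b‖ ^ q + ω t := fun R C ω =>
    eventually_congr (hae.mono fun t ht => by simp only [ht])
  simp only [hint, hgrowth]
  exact ⟨fun h R hR => growth_of_integrable_comp hT hq hΘ h hR,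
    fun h x u hx hu => integrable_comp_of_growth hq hΘ h hx hu⟩
end
end
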